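/- arXiv:1111.1016 — 2 statements merged into one kernel-verified Lean document; each statement's English description precedes it below -/
import Mathlib

section
/- Let J ⊆ S, d = (d_σ)_{σ∈S∖J} nonnegative integers, χ1, χ2 : F^× → E^× locally J-analytic characters, r = −v_p(χ1(p)) ≥ 0, J' = J ∪ {σ ∈ S∖J : d_σ + 1 > r}, χ1' = χ1, χ2' = χ2 · ∏_{σ∈J'∖J} σ^{d_σ}, d' = (d_σ)_{σ∈S∖J'}, and assume v_p(χ1(p)) + v_p(χ2(p)) + |d| = 0 (equivalently v_p(χ1'(p)) + v_p(χ2'(p)) + |d'| = 0). Then for every a ∈ F, every m = (m_σ)_{σ∈J'} ∈ ℤ≥0^{J'} and every multi-index k = (k_σ)_{σ∈S∖J'} with 0 ≤ k_σ ≤ d_σ and r − |k| − |m| > 0, the functions F → E given by z ↦ z^k z^m, and by z ↦ χ2'χ1'^{−1}(z−a) (z−a)^{d'−k} (z−a)^{−m} for z ≠ a and value 0 at z = a, belong to B(χ',J',d'). In particular the function O_F → E equal to χ2'χ1'^{−1}(z) z^{d'−k} z^{−m} for z ≠ 0 and to 0 at z = 0 lies in C^r(O_F,J',d'). -/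
/- Preamble: formalization of the basic objects from "Fonctions de classe C^r sur O_F"
   (C^r functions on O_F, locally analytic functions, locally J-analytic characters,
   the spaces V(χ,J,d), B(χ,J,d), the lattice Λ, etc.).

   Conventions:
   * F, E are nonarchimedean complete normed fields (abstracting finite extensions of ℚ_p);
   * O_F is encoded by the predicate ‖·‖ ≤ 1, and functions on O_F are encoded as
     functions on F whose defining conditions only quantify over the unit ball;
   * `q` is the residue cardinality, `ϖ` a uniformizer with ‖ϖ‖ = q⁻¹,
     and D(a,n) = {z : ‖z - a‖ ≤ q^(-n)};
   * S is the (finite) set of embeddings F → E, `emb σ` the corresponding ring maps;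
   * multi-indices are functions `i : S → ℕ`; a pair (k over S∖J, m over J) is encoded
     as the single multi-index agreeing with k off J and with m on J. -/

open scoped Classical Topology
open Filter

noncomputable section

namespace Paper

variable {F E : Type*} [NormedField F] [NormedField E]
variable {S : Type*} [Fintype S]

/-- total degree |i| of a multi-index -/
def mSum (i : S → ℕ) : ℕ := ∑ σ, i σ

/-- i! -/
def mFact (i : S → ℕ) : ℕ := ∏ σ, (i σ).factorial

/-- z^i = ∏_σ σ(z)^(i_σ) -/
def mPow (emb : S → (F →+* E)) (z : F) (i : S → ℕ) : E := ∏ σ, (emb σ z) ^ (i σ)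

/-- the (finite) set of multi-indices of total degree ≤ N -/
def degLE (S : Type*) [Fintype S] (N : ℕ) : Finset (S → ℕ) :=
  ((Finset.univ : Finset (S → Fin (N + 1))).image (fun i σ => (i σ : ℕ))).filter
    (fun i => mSum i ≤ N)

/-- the remainder ε_{f,N}(x,y) = f(x+y) - Σ_{|i| ≤ N} D_i f(x) y^i / i! -/
def crRem (emb : S → (F →+* E)) (N : ℕ) (f : F → E) (Df : (S → ℕ) → F → E)
    (x y : F) : E :=
  f (x + y) - ∑ i ∈ degLE S N, Df i x * mPow emb y i / (mFact i : E)

/-- `f` is of class C^r on O_F with derivative data `Df`: the `Df i` (|i| ≤ ⌊r⌋) are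
bounded on O_F and C_{f,r}(h) = sup_{x ∈ O_F, y ∈ ϖ^h O_F} |ε_{f,[r]}(x,y)| q^{rh} → 0. -/
def IsCrWith (q : ℕ) (emb : S → (F →+* E)) (r : ℝ) (f : F → E)
    (Df : (S → ℕ) → F → E) : Prop :=
  (∀ i : S → ℕ, mSum i ≤ ⌊r⌋₊ → ∃ C : ℝ, ∀ x : F, ‖x‖ ≤ 1 → ‖Df i x‖ ≤ C) ∧
  ∀ ε : ℝ, 0 < ε → ∃ H : ℕ, ∀ h : ℕ, H ≤ h → ∀ x y : F, ‖x‖ ≤ 1 →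
    ‖y‖ ≤ (q : ℝ) ^ (-(h : ℤ)) →
      ‖crRem emb ⌊r⌋₊ f Df x y‖ * (q : ℝ) ^ (r * (h : ℝ)) ≤ ε

/-- `f` is of class C^r on O_F -/
def IsCr (q : ℕ) (emb : S → (F →+* E)) (r : ℝ) (f : F → E) : Prop :=
  ∃ Df, IsCrWith q emb r f Df

/-- the C^r norm computed from derivative data `Df` -/
def crNormWith (emb : S → (F →+* E)) (r : ℝ) (f : F → E)
    (Df : (S → ℕ) → F → E) : ℝ :=
  sSup ({x | ∃ i : S → ℕ, mSum i ≤ ⌊r⌋₊ ∧ ∃ z : F, ‖z‖ ≤ 1 ∧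
          x = ‖Df i z / (mFact i : E)‖} ∪
        {x | ∃ z y : F, ‖z‖ ≤ 1 ∧ ‖y‖ ≤ 1 ∧ y ≠ 0 ∧
          x = ‖crRem emb ⌊r⌋₊ f Df z y‖ / ‖y‖ ^ r})

/-- the C^r norm of `f` (the derivative data being unique, the set below is a singleton
when `f` is of class C^r). -/
def crNorm (q : ℕ) (emb : S → (F →+* E)) (r : ℝ) (f : F → E) : ℝ :=
  sSup {c | ∃ Df, IsCrWith q emb r f Df ∧ c = crNormWith emb r f Df}

/-- membership in the closed subspace C^r(O_F, J, d) of C^r(O_F, E):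
∂^{dσ+1} f / ∂z_σ^{dσ+1} = 0 for σ ∉ J. -/
def IsCrJ (q : ℕ) (emb : S → (F →+* E)) (r : ℝ) (J : Set S) (d : S → ℕ)
    (f : F → E) : Prop :=
  ∃ Df, IsCrWith q emb r f Df ∧
    ∀ σ : S, σ ∉ J → ∀ x : F, ‖x‖ ≤ 1 → Df (Pi.single σ (d σ + 1)) x = 0

/-- `c` is the family of Taylor coefficients of an expansion of `f` on D(a,h), with
exponents bounded by `d` off `J`, and coefficients with ‖c m‖ q^{-h|m|} → 0. -/
def IsExpansionAt (q : ℕ) (emb : S → (F →+* E)) (J : Set S) (d : S → ℕ) (h : ℕ)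
    (a : F) (c : (S → ℕ) → E) (f : F → E) : Prop :=
  (∀ m : S → ℕ, ¬ (∀ σ, σ ∉ J → m σ ≤ d σ) → c m = 0) ∧
  Tendsto (fun m : S → ℕ => ‖c m‖ * (q : ℝ) ^ (-(h : ℝ) * (mSum m : ℝ)))
    cofinite (nhds 0) ∧
  ∀ z : F, ‖z - a‖ ≤ (q : ℝ) ^ (-(h : ℤ)) →
    HasSum (fun m : S → ℕ => c m * mPow emb (z - a) m) (f z)

/-- membership in F_h(O_F, J, d) -/
def IsFh (q : ℕ) (emb : S → (F →+* E)) (J : Set S) (d : S → ℕ) (h : ℕ)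
    (f : F → E) : Prop :=
  ∀ a : F, ‖a‖ ≤ 1 → ∃ c : (S → ℕ) → E, IsExpansionAt q emb J d h a c f

/-- membership in F(O_F, J, d) = ∪_h F_h(O_F, J, d) -/
def IsF (q : ℕ) (emb : S → (F →+* E)) (J : Set S) (d : S → ℕ) (f : F → E) : Prop :=
  ∃ h : ℕ, IsFh q emb J d h f

/-- the norm of F_h(O_F, J, d) -/
def FhNorm (q : ℕ) (emb : S → (F →+* E)) (J : Set S) (d : S → ℕ) (h : ℕ)
    (f : F → E) : ℝ :=
  sSup {x | ∃ a : F, ‖a‖ ≤ 1 ∧ ∃ c : (S → ℕ) → E, IsExpansionAt q emb J d h a c f ∧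
        ∃ m : S → ℕ, x = ‖c m‖ * (q : ℝ) ^ (-(h : ℝ) * (mSum m : ℝ))}

/-- membership in F^N(O_F, J, d): member of F(O_F,J,d) which is a sum of members of the
spaces F(O_F, ∅, d'') over multi-indices d'' of total degree ≤ N. -/
def IsFN (q : ℕ) (emb : S → (F →+* E)) (J : Set S) (d : S → ℕ) (N : ℕ)
    (f : F → E) : Prop :=
  IsF q emb J d f ∧ ∃ g : (S → ℕ) → (F → E),
    (∀ m ∈ degLE S N, IsF q emb (∅ : Set S) m (g m)) ∧
    ∀ z : F, ‖z‖ ≤ 1 → f z = ∑ m ∈ degLE S N, g m z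

/-- |d| = Σ_{σ ∉ J} d_σ -/
def dSum (J : Set S) (d : S → ℕ) : ℕ :=
  ∑ σ ∈ Finset.univ.filter (fun σ => σ ∉ J), d σ

/-- z^d = ∏_{σ ∉ J} σ(z)^{d_σ} -/
def dPow (emb : S → (F →+* E)) (J : Set S) (d : S → ℕ) (z : F) : E :=
  ∏ σ ∈ Finset.univ.filter (fun σ => σ ∉ J), (emb σ z) ^ (d σ)

/-- z^{d-k} z^{-m} where (k, m) is encoded by the single multi-index `i`
(k = i off J, m = i on J). -/
def negPow (emb : S → (F →+* E)) (J : Set S) (d : S → ℕ) (i : S → ℕ) (z : F) : E :=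
  (∏ σ ∈ Finset.univ.filter (fun σ => σ ∉ J), (emb σ z) ^ (d σ - i σ)) /
    (∏ σ ∈ Finset.univ.filter (fun σ => σ ∈ J), (emb σ z) ^ (i σ))

/-- the function 1_{D(a,n)}(z) (z-a)^i -/
def test1 (q : ℕ) (emb : S → (F →+* E)) (a : F) (n : ℤ) (i : S → ℕ) : F → E :=
  fun z => if ‖z - a‖ ≤ (q : ℝ) ^ (-n) then mPow emb (z - a) i else 0

/-- the function χ2 χ1⁻¹ -/
def chRatio (χ1 χ2 : F →* E) (z : F) : E := χ2 z / χ1 z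

/-- the function 1_{F∖D(a,n+1)}(z) χ2χ1⁻¹(z-a) (z-a)^{d-k} (z-a)^{-m} -/
def test2 (q : ℕ) (emb : S → (F →+* E)) (J : Set S) (d : S → ℕ) (χ1 χ2 : F →* E)
    (a : F) (n : ℤ) (i : S → ℕ) : F → E :=
  fun z => if ‖z - a‖ ≤ (q : ℝ) ^ (-(n + 1)) then 0
    else chRatio χ1 χ2 (z - a) * negPow emb J d i (z - a)

/-- the ϖ-adic valuation v(a) (so that ‖a‖ = q^{-v(a)} for a ≠ 0) -/
def valF (q : ℕ) (a : F) : ℤ := ⌊-(Real.logb q ‖a‖)⌋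

/-- the function 1_{D(1/a, n - 2v(a))}(z) χ2χ1⁻¹(z) z^d (1/z - a)^k (1/z - a)^m -/
def test3 (q : ℕ) (emb : S → (F →+* E)) (J : Set S) (d : S → ℕ) (χ1 χ2 : F →* E)
    (a : F) (n : ℤ) (i : S → ℕ) : F → E :=
  fun z => if ‖z - a⁻¹‖ ≤ (q : ℝ) ^ (-(n - 2 * valF q a))
    then chRatio χ1 χ2 z * dPow emb J d z * mPow emb (z⁻¹ - a) i else 0

/-- locally J-analytic character: continuous on F^× and, on each disk D(a,l) around a
unit, given by a convergent power series in the variables (σ(z) - σ(a))_{σ ∈ J}. -/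
def IsLocJChar (q : ℕ) (emb : S → (F →+* E)) (J : Set S) (χ : F →* E) : Prop :=
  ContinuousOn (χ : F → E) {z : F | z ≠ 0} ∧
  ∃ l : ℕ, ∀ a : F, ‖a‖ = 1 → ∃ c : (S → ℕ) → E,
    (∀ m : S → ℕ, ¬ (∀ σ, σ ∉ J → m σ = 0) → c m = 0) ∧
    ∀ z : F, ‖z - a‖ ≤ (q : ℝ) ^ (-(l : ℤ)) →
      HasSum (fun m : S → ℕ => c m * mPow emb (z - a) m) (χ z)

/-- the valuation v_p on E normalized by v_p(p) = 1, given that ‖x‖ = p^{-ef·v_p(x)}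
(ef = [F:ℚ_p]). -/
def vP (p : ℕ) (ef : ℕ) (x : E) : ℝ := -(Real.logb p ‖x‖) / (ef : ℝ)

/-- the monomial character z ↦ ∏_{σ ∈ T} σ(z)^{d_σ} -/
def monChar (emb : S → (F →+* E)) (T : Set S) (d : S → ℕ) : F →* E where
  toFun z := ∏ σ ∈ Finset.univ.filter (fun σ => σ ∈ T), (emb σ z) ^ (d σ)
  map_one' := by simp
  map_mul' := by
    intro x y
    simp [map_mul, mul_pow, Finset.prod_mul_distrib]

/-- `g` is (on O_F ∖ {0}) the function z ↦ χ2χ1⁻¹(z) z^d f(1/z); i.e. `g` is an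
extension to O_F of the second-chart transform of `f`. -/
def ExtProp (emb : S → (F →+* E)) (J : Set S) (d : S → ℕ) (χ1 χ2 : F →* E)
    (f g : F → E) : Prop :=
  ∀ z : F, z ≠ 0 → ‖z‖ ≤ 1 → g z = chRatio χ1 χ2 z * dPow emb J d z * f z⁻¹

/-- membership in V(χ, J, d) (global sections of the locally analytic sheaf) -/
def MemV (q : ℕ) (emb : S → (F →+* E)) (J : Set S) (d : S → ℕ) (χ1 χ2 : F →* E)
    (f : F → E) : Prop :=
  IsF q emb J d f ∧ ∃ g : F → E, IsF q emb J d g ∧ ExtProp emb J d χ1 χ2 f g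

/-- membership in the Banach space B(χ, J, d) -/
def MemB (q : ℕ) (emb : S → (F →+* E)) (r : ℝ) (J : Set S) (d : S → ℕ)
    (χ1 χ2 : F →* E) (f : F → E) : Prop :=
  IsCrJ q emb r J d f ∧ ∃ g : F → E, IsCrJ q emb r J d g ∧ ExtProp emb J d χ1 χ2 f g

/-- the norm of B(χ, J, d): ‖f‖_B = max(‖f₁‖_{C^r}, ‖f₂‖_{C^r}) where
f₁(z) = f(ϖ z) and f₂ is the extension of z ↦ χ2χ1⁻¹(z) z^d f(1/z). -/
def BNorm (q : ℕ) (emb : S → (F →+* E)) (r : ℝ) (J : Set S) (d : S → ℕ)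
    (χ1 χ2 : F →* E) (ϖ : F) (f : F → E) : ℝ :=
  sSup {x | ∃ g : F → E, IsCrJ q emb r J d g ∧ ExtProp emb J d χ1 χ2 f g ∧
    x = max (crNorm q emb r (fun z => f (ϖ * z))) (crNorm q emb r g)}

/-- the ring of integers O_E as a subring of E -/
def unitBall (E : Type*) [NormedField E] [IsUltrametricDist E] : Subring E where
  carrier := {x : E | ‖x‖ ≤ 1}
  mul_mem' := by
    intro a b ha hb
    simp only [Set.mem_setOf_eq] at *
    calc ‖a * b‖ = ‖a‖ * ‖b‖ := norm_mul a b
    _ ≤ 1 * 1 := mul_le_mul ha hb (norm_nonneg b) zero_le_one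
    _ = 1 := one_mul 1
  one_mem' := by simp
  add_mem' := by
    intro a b ha hb
    simp only [Set.mem_setOf_eq] at *
    exact le_trans (IsUltrametricDist.norm_add_le_max a b) (max_le ha hb)
  zero_mem' := by simp
  neg_mem' := by
    intro a ha
    simpa using ha

instance (E : Type*) [NormedField E] [IsUltrametricDist E] :
    Algebra (unitBall E) E := (unitBall E).subtype.toAlgebra

/-- the action of the Borel element [[t, u], [0, v]] on functions -/
def borelAct (emb : S → (F →+* E)) (J : Set S) (d : S → ℕ) (χ1 χ2 : F →* E)
    (t u v : F) (f : F → E) : F → E :=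
  fun z => χ1 (t * v) * chRatio χ1 χ2 t * dPow emb J d t * f ((v * z - u) / t)

/-- the generator 1_{O_F}(z) z^k z^m -/
def genPoly (emb : S → (F →+* E)) (i : S → ℕ) : F → E :=
  fun z => if ‖z‖ ≤ 1 then mPow emb z i else 0

/-- the generator 1_{F∖O_F}(z) χ2χ1⁻¹(z) z^{d-k} z^{-m} -/
def genSing (emb : S → (F →+* E)) (J : Set S) (d : S → ℕ) (χ1 χ2 : F →* E)
    (i : S → ℕ) : F → E :=
  fun z => if ‖z‖ ≤ 1 then 0 else chRatio χ1 χ2 z * negPow emb J d i z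

/-- the generating set of Λ: Borel translates of the basic generators -/
def lambdaGens (emb : S → (F →+* E)) (J : Set S) (d : S → ℕ) (χ1 χ2 : F →* E) :
    Set (F → E) :=
  {h | ∃ t u v : F, ∃ i : S → ℕ, t ≠ 0 ∧ v ≠ 0 ∧ (∀ σ, σ ∉ J → i σ ≤ d σ) ∧
    (h = borelAct emb J d χ1 χ2 t u v (genPoly emb i) ∨
     h = borelAct emb J d χ1 χ2 t u v (genSing emb J d χ1 χ2 i))}

/-- the O_E[P]-lattice Λ -/
def Lambda [IsUltrametricDist E] (emb : S → (F →+* E)) (J : Set S) (d : S → ℕ)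
    (χ1 χ2 : F →* E) : Submodule ↥(unitBall E) (F → E) :=
  Submodule.span ↥(unitBall E) (lambdaGens emb J d χ1 χ2)

/-- the gauge (jauge) ‖f‖_Λ = inf{‖λ‖ : λ ∈ E^×, f ∈ λΛ} of a lattice Λ -/
def lamGauge [IsUltrametricDist E] (Λ : Submodule ↥(unitBall E) (F → E))
    (f : F → E) : ℝ :=
  sInf {c : ℝ | ∃ lam : E, lam ≠ 0 ∧ c = ‖lam‖ ∧ ∃ g, g ∈ Λ ∧ f = lam • g}

/-- the formula for the action of g = (a b; c d) ∈ GL₂(F):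
(g·f)(z) = χ1(det g) χ2χ1⁻¹(-cz+a) (-cz+a)^d f((dz-b)/(-cz+a)) -/
def actFormula (emb : S → (F →+* E)) (J : Set S) (d : S → ℕ) (χ1 χ2 : F →* E)
    (g : Matrix (Fin 2) (Fin 2) F) (f : F → E) : F → E :=
  fun z => χ1 (g 0 0 * g 1 1 - g 0 1 * g 1 0) *
    chRatio χ1 χ2 (-(g 1 0) * z + g 0 0) * dPow emb J d (-(g 1 0) * z + g 0 0) *
    f ((g 1 1 * z - g 0 1) / (-(g 1 0) * z + g 0 0))

/-- the action of g ∈ GL₂(F) on functions, extended by continuity (i.e. by taking the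
limit) at the singular point z = a/c when c ≠ 0. -/
def gAct (emb : S → (F →+* E)) (J : Set S) (d : S → ℕ) (χ1 χ2 : F →* E)
    (g : Matrix (Fin 2) (Fin 2) F) (f : F → E) : F → E :=
  fun z => if g 1 0 ≠ 0 ∧ z = g 0 0 / g 1 0 then
      limUnder (𝓝[≠] z) (actFormula emb J d χ1 χ2 g f)
    else actFormula emb J d χ1 χ2 g f z

/-- μ belongs to I(χ,J,d)^∨: both components of μ restrict to continuous linear forms
on each Banach space F_h(O_F,J,d). -/
def MemIdual (q : ℕ) (emb : S → (F →+* E)) (J : Set S) (d : S → ℕ) (χ1 χ2 : F →* E)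
    (ϖ : F) (μ : (F → E) →ₗ[E] E) : Prop :=
  ∀ h : ℕ, ∃ K : ℝ, ∀ f g : F → E,
    IsFh q emb J d h (fun z => f (ϖ * z)) → IsFh q emb J d h g →
    ExtProp emb J d χ1 χ2 f g →
    ‖μ f‖ ≤ K * max (FhNorm q emb J d h (fun z => f (ϖ * z))) (FhNorm q emb J d h g)

/-- ν is a continuous (= bounded) linear form on the Banach space B(χ,J,d) -/
def BBounded (q : ℕ) (emb : S → (F →+* E)) (r : ℝ) (J : Set S) (d : S → ℕ)
    (χ1 χ2 : F →* E) (ϖ : F) (ν : (F → E) →ₗ[E] E) : Prop :=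
  ∃ K : ℝ, ∀ f : F → E, MemB q emb r J d χ1 χ2 f →
    ‖ν f‖ ≤ K * BNorm q emb r J d χ1 χ2 ϖ f

/-- the function z ↦ z^k z^m (a generator of L(χ,J,d)) -/
def lFun1 (emb : S → (F →+* E)) (i : S → ℕ) : F → E := fun z => mPow emb z i

/-- the function z ↦ χ2χ1⁻¹(z-a) (z-a)^{d-k} (z-a)^{-m} (value 0 at z = a),
a generator of L(χ,J,d) -/
def lFun2 (emb : S → (F →+* E)) (J : Set S) (d : S → ℕ) (χ1 χ2 : F →* E)
    (a : F) (i : S → ℕ) : F → E :=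
  fun z => if z = a then 0 else chRatio χ1 χ2 (z - a) * negPow emb J d i (z - a)

/-- the generating set of L(χ,J,d) -/
def lGens (emb : S → (F →+* E)) (J : Set S) (d : S → ℕ) (χ1 χ2 : F →* E)
    (r : ℝ) : Set (F → E) :=
  {h | ∃ i : S → ℕ, (∀ σ, σ ∉ J → i σ ≤ d σ) ∧ (mSum i : ℝ) < r ∧
    (h = lFun1 emb i ∨ ∃ a : F, h = lFun2 emb J d χ1 χ2 a i)}

/-- the distance in B(χ,J,d) from f to the subspace L(χ,J,d), i.e. the quotient
seminorm of B(χ,J,d)/L(χ,J,d) evaluated at the image of f. -/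
def distL (q : ℕ) (emb : S → (F →+* E)) (r : ℝ) (J : Set S) (d : S → ℕ)
    (χ1 χ2 : F →* E) (ϖ : F) (f : F → E) : ℝ :=
  sInf {x | ∃ l ∈ Submodule.span E (lGens emb J d χ1 χ2 r),
    x = BNorm q emb r J d χ1 χ2 ϖ (f - l)}

/-- the GL₂(F)-stable lattice generated by Λ under the group action -/
def LambdaG [IsUltrametricDist E] (emb : S → (F →+* E)) (J : Set S) (d : S → ℕ)
    (χ1 χ2 : F →* E) : Submodule ↥(unitBall E) (F → E) :=
  Submodule.span ↥(unitBall E)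
    {h | ∃ g : Matrix (Fin 2) (Fin 2) F, g 0 0 * g 1 1 - g 0 1 * g 1 0 ≠ 0 ∧
      ∃ x, x ∈ Lambda emb J d χ1 χ2 ∧ h = gAct emb J d χ1 χ2 g x}

/-- C^{r,id} remainder for h : O_F → F -/
def crRemId (N : ℕ) (h : F → F) (Dh : ℕ → F → F) (x y : F) : F :=
  h (x + y) - ∑ i ∈ Finset.range (N + 1), Dh i x * y ^ i / (Nat.factorial i : F)

/-- h : O_F → F is of class C^{r,id} -/
def IsCrId (q : ℕ) (r : ℝ) (h : F → F) : Prop :=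
  ∃ Dh : ℕ → F → F,
    (∀ i : ℕ, i ≤ ⌊r⌋₊ → ∃ C : ℝ, ∀ x : F, ‖x‖ ≤ 1 → ‖Dh i x‖ ≤ C) ∧
    ∀ ε : ℝ, 0 < ε → ∃ K : ℕ, ∀ k : ℕ, K ≤ k → ∀ x y : F, ‖x‖ ≤ 1 →
      ‖y‖ ≤ (q : ℝ) ^ (-(k : ℤ)) → ‖crRemId ⌊r⌋₊ h Dh x y‖ * (q : ℝ) ^ (r * (k : ℝ)) ≤ ε

/-- the set of values defining the dual norm ‖μ‖_{r,d} -/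
def dualSet (q : ℕ) (emb : S → (F →+* E)) (r : ℝ) (J : Set S) (d : S → ℕ)
    (μ : (F → E) →ₗ[E] E) : Set ℝ :=
  {x | ∃ (a : F) (n : ℕ) (i : S → ℕ), ‖a‖ ≤ 1 ∧ (∀ σ, σ ∉ J → i σ ≤ d σ) ∧
    x = ‖μ (test1 q emb a (n : ℤ) i)‖ * (q : ℝ) ^ (-(n : ℝ) * (r - (mSum i : ℝ)))}

/-- the dual norm ‖μ‖_{r,d} -/
def dualNorm (q : ℕ) (emb : S → (F →+* E)) (r : ℝ) (J : Set S) (d : S → ℕ)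
    (μ : (F → E) →ₗ[E] E) : ℝ :=
  sSup (dualSet q emb r J d μ)

/-- the operator norm of μ on C^r(O_F, J, d) -/
def opNorm (q : ℕ) (emb : S → (F →+* E)) (r : ℝ) (J : Set S) (d : S → ℕ)
    (μ : (F → E) →ₗ[E] E) : ℝ :=
  sSup {x | ∃ f : F → E, IsCrJ q emb r J d f ∧ crNorm q emb r f ≠ 0 ∧
    x = ‖μ f‖ / crNorm q emb r f}


/-! ### Multi-indices -/

lemma mem_degLE {N : ℕ} {j : S → ℕ} : j ∈ degLE S N ↔ mSum j ≤ N := by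
  unfold degLE
  simp only [Finset.mem_filter, Finset.mem_image, Finset.mem_univ, true_and,
    and_iff_right_iff_imp]
  intro hj
  refine ⟨fun σ => ⟨j σ, Nat.lt_succ_of_le (le_trans ?_ hj)⟩, rfl⟩
  exact Finset.single_le_sum (f := j) (fun _ _ => Nat.zero_le _) (Finset.mem_univ σ)

lemma mPow_mul_base (emb : S → (F →+* E)) (x y : F) (i : S → ℕ) :
    mPow emb (x * y) i = mPow emb x i * mPow emb y i := by
  simp [mPow, mul_pow, Finset.prod_mul_distrib]

lemma norm_mPow {emb : S → (F →+* E)} (hemb : ∀ (σ : S) (z : F), ‖emb σ z‖ = ‖z‖)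
    (z : F) (i : S → ℕ) : ‖mPow emb z i‖ = ‖z‖ ^ mSum i := by
  simp [mPow, mSum, norm_prod, hemb, Finset.prod_pow_eq_pow_sum]

/-- the multinomial expansion of `(x + y)^i` -/
lemma mPow_add (emb : S → (F →+* E)) (x y : F) (i : S → ℕ) :
    mPow emb (x + y) i = ∑ k ∈ Fintype.piFinset fun σ => Finset.range (i σ + 1),
      (∏ σ, ((i σ).choose (k σ) : E)) * mPow emb x (fun σ => i σ - k σ) * mPow emb y k := by
  have h : ∀ σ, (emb σ (x + y)) ^ i σ = ∑ n ∈ Finset.range (i σ + 1),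
      ((i σ).choose n : E) * (emb σ x) ^ (i σ - n) * (emb σ y) ^ n := by
    intro σ
    rw [map_add, add_comm, add_pow]
    exact Finset.sum_congr rfl fun n _ => by ring
  simp only [mPow, h, Finset.prod_univ_sum, Finset.prod_mul_distrib]

/-! ### Local expansions at `1` -/

section Jets

open Asymptotics MvPolynomial

set_option linter.unusedSectionVars false

/-- `f (1 + y)` agrees up to `O(‖y‖^(N+1))` with a polynomial in the `σ(y)` whose degree in
`σ(y)` is at most `b σ` for `σ ∉ J`. -/
def HasJetOne (emb : S → (F →+* E)) (N : ℕ) (J : Set S) (b : S → ℕ) (f : F → E) : Prop :=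
  ∃ P : MvPolynomial S E, (∀ σ, σ ∉ J → degreeOf σ P ≤ b σ) ∧
    (fun y : F => f (1 + y) - eval (fun σ => emb σ y) P) =O[𝓝 0] fun y : F => ‖y‖ ^ (N + 1)

variable {emb : S → (F →+* E)} {N : ℕ} {J : Set S} {b b' : S → ℕ} {f g : F → E}

lemma continuous_eval_emb (hemb : ∀ (σ : S) (z : F), ‖emb σ z‖ = ‖z‖) (P : MvPolynomial S E) :
    Continuous fun y : F => eval (fun σ => emb σ y) P := by
  refine (MvPolynomial.continuous_eval P).comp (continuous_pi fun σ => ?_)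
  exact (AddMonoidHomClass.isometry_of_norm (emb σ) (hemb σ)).continuous

lemma isBigO_eval_emb_one (hemb : ∀ (σ : S) (z : F), ‖emb σ z‖ = ‖z‖)
    (P : MvPolynomial S E) :
    (fun y : F => eval (fun σ => emb σ y) P) =O[𝓝 0] fun _ : F => (1 : ℝ) :=
  ((continuous_eval_emb hemb P).tendsto 0).isBigO_one ℝ

lemma isBigO_eval_emb_sub (hemb : ∀ (σ : S) (z : F), ‖emb σ z‖ = ‖z‖)
    (P : MvPolynomial S E) :
    (fun y : F => eval (fun σ => emb σ y) P - eval (fun σ => emb σ (0 : F)) P)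
      =O[𝓝 0] fun y : F => ‖y‖ := by
  induction P using MvPolynomial.induction_on with
  | C a => simpa using isBigO_zero _ _
  | add p q hp hq =>
    refine (hp.add hq).congr_left fun y => ?_
    simp only [map_add]; ring
  | mul_X p σ _ =>
    have h : (fun y : F => emb σ y) =O[𝓝 0] fun y : F => ‖y‖ :=
      IsBigO.of_norm_right (IsBigO.of_bound 1 (Eventually.of_forall fun y => by simp [hemb]))
    simpa using (isBigO_eval_emb_one hemb p).mul h

lemma isBigO_pow_succ_one (n : ℕ) :
    (fun y : F => ‖y‖ ^ n) =O[𝓝 0] fun _ : F => (1 : ℝ) :=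
  ((continuous_norm.pow n).tendsto (0 : F)).isBigO_one ℝ

lemma isBigO_pow_norm {n m : ℕ} (h : m ≤ n) :
    (fun y : F => ‖y‖ ^ n) =O[𝓝 0] fun y : F => ‖y‖ ^ m := by
  obtain ⟨k, rfl⟩ := Nat.exists_eq_add_of_le h
  simpa [pow_add] using (isBigO_refl (fun y : F => ‖y‖ ^ m) (𝓝 0)).mul (isBigO_pow_succ_one k)

lemma HasJetOne.isBigO_one (hemb : ∀ (σ : S) (z : F), ‖emb σ z‖ = ‖z‖)
    (hf : HasJetOne emb N J b f) :
    (fun y : F => f (1 + y)) =O[𝓝 0] fun _ : F => (1 : ℝ) := by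
  obtain ⟨P, -, hP⟩ := hf
  simpa using (hP.trans (isBigO_pow_succ_one _)).add (isBigO_eval_emb_one hemb P)

lemma HasJetOne.mono {J' : Set S} (hf : HasJetOne emb N J b f) (hJ : J ⊆ J')
    (hb : ∀ σ, σ ∉ J' → b σ ≤ b' σ) : HasJetOne emb N J' b' f := by
  obtain ⟨P, hd, hP⟩ := hf
  exact ⟨P, fun σ hσ => (hd σ fun h => hσ (hJ h)).trans (hb σ hσ), hP⟩

lemma HasJetOne.congr (hf : HasJetOne emb N J b f)
    (h : ∀ᶠ y : F in 𝓝 0, f (1 + y) = g (1 + y)) : HasJetOne emb N J b g := by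
  obtain ⟨P, hd, hP⟩ := hf
  exact ⟨P, hd, hP.congr' (h.mono fun y hy => by simp only [hy]) EventuallyEq.rfl⟩

lemma HasJetOne.mul (hemb : ∀ (σ : S) (z : F), ‖emb σ z‖ = ‖z‖)
    (hf : HasJetOne emb N J b f) (hg : HasJetOne emb N J b' g) :
    HasJetOne emb N J (b + b') (fun z => f z * g z) := by
  have hf1 := hf.isBigO_one hemb
  obtain ⟨P, hPd, hP⟩ := hf
  obtain ⟨Q, hQd, hQ⟩ := hg
  refine ⟨P * Q, fun σ hσ => (degreeOf_mul_le σ P Q).trans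
    (add_le_add (hPd σ hσ) (hQd σ hσ)), ?_⟩
  have h1 := hf1.mul hQ
  have h2 := hP.mul (isBigO_eval_emb_one hemb Q)
  simp only [one_mul, mul_one] at h1 h2
  refine (h1.add h2).congr_left fun y => ?_
  simp only [map_mul]; ring

lemma eval_zero_of_isBigO {P : MvPolynomial S E}
    (hP : (fun y : F => f (1 + y) - eval (fun σ => emb σ y) P)
      =O[𝓝 0] fun y : F => ‖y‖ ^ (N + 1)) : eval (fun σ => emb σ (0 : F)) P = f 1 := by
  obtain ⟨C, hC⟩ := hP.bound
  have := hC.self_of_nhds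
  simp only [add_zero, norm_zero, ne_eq, Nat.succ_ne_zero, not_false_eq_true, zero_pow,
    mul_zero, norm_le_zero_iff] at this
  exact (sub_eq_zero.mp this).symm

lemma HasJetOne.inv (hemb : ∀ (σ : S) (z : F), ‖emb σ z‖ = ‖z‖)
    (hf : HasJetOne emb N J 0 f) (h1 : f 1 = 1) :
    HasJetOne emb N J 0 (fun z => (f z)⁻¹) := by
  have hf1 := hf.isBigO_one hemb
  obtain ⟨P, hPd, hP⟩ := id hf
  have hP0 : eval (fun σ => emb σ (0 : F)) P = 1 := (eval_zero_of_isBigO hP).trans h1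
  have hpow : Tendsto (fun y : F => ‖y‖ ^ (N + 1)) (𝓝 0) (𝓝 0) := by
    have h : Continuous fun y : F => ‖y‖ ^ (N + 1) := by fun_prop
    simpa using h.tendsto 0
  have hlim : Tendsto (fun y : F => f (1 + y)) (𝓝 0) (𝓝 1) := by
    have h := (hP.trans_tendsto hpow).add ((continuous_eval_emb hemb P).tendsto (0 : F))
    rw [hP0] at h
    simpa only [sub_add_cancel, zero_add] using h
  have hinv : (fun y : F => (f (1 + y))⁻¹) =O[𝓝 0] fun _ : F => (1 : ℝ) :=
    (hlim.inv₀ one_ne_zero).isBigO_one ℝ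
  have hne : ∀ᶠ y : F in 𝓝 0, f (1 + y) ≠ 0 := hlim.eventually_ne one_ne_zero
  refine ⟨∑ n ∈ Finset.range (N + 1), (1 - P) ^ n, fun σ hσ => ?_, ?_⟩
  · refine (degreeOf_sum_le σ _ _).trans (Finset.sup_le fun n _ => ?_)
    refine (degreeOf_pow_le σ _ n).trans ?_
    have h : degreeOf σ (1 - P) ≤ 0 := by
      refine (degreeOf_sub_le σ 1 P).trans (max_le ?_ (hPd σ hσ))
      simp [degreeOf_one]
    simp [Nat.le_zero.mp h]
  · set Q := ∑ n ∈ Finset.range (N + 1), (1 - P) ^ n with hQ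
    have hPQ : P * Q = 1 - (1 - P) ^ (N + 1) := by
      rw [hQ, ← mul_neg_geom_sum (1 - P) (N + 1)]; ring
    have hsub : (fun y : F => eval (fun σ => emb σ y) (1 - P)) =O[𝓝 0] fun y : F => ‖y‖ := by
      refine (isBigO_eval_emb_sub hemb P).neg_left.congr_left fun y => ?_
      rw [hP0]; simp
    have hA := hsub.pow (N + 1)
    have hB := hP.mul (isBigO_eval_emb_one hemb Q)
    simp only [mul_one] at hB
    have hC := hinv.mul (hA.sub hB)
    simp only [one_mul] at hC
    refine hC.congr' (hne.mono fun y hy => ?_) EventuallyEq.rfl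
    have hPQy := congrArg (eval fun σ => emb σ y) hPQ
    simp only [map_mul, map_sub, map_one, map_pow] at hPQy
    simp only [map_sub, map_one]
    have h' : (1 - eval (fun σ => emb σ y) P) ^ (N + 1)
        = 1 - eval (fun σ => emb σ y) P * eval (fun σ => emb σ y) Q := by
      rw [hPQy]; ring
    rw [h']
    field_simp
    ring

/-- monomial functions have exact polynomial expansions -/
lemma hasJetOne_prod (A : Finset S) (n : S → ℕ) :
    HasJetOne emb N J (fun σ => if σ ∈ A then n σ else 0)
      (fun z => ∏ σ ∈ A, (emb σ z) ^ n σ) := by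
  refine ⟨∏ σ ∈ A, (1 + X σ) ^ n σ, fun τ _ => ?_, ?_⟩
  · refine (degreeOf_prod_le τ A _).trans ?_
    have h : ∀ σ ∈ A, degreeOf τ ((1 + X σ : MvPolynomial S E) ^ n σ)
        ≤ if σ = τ then n σ else 0 := by
      intro σ _
      refine (degreeOf_pow_le τ _ _).trans ?_
      have h1 : degreeOf τ (1 + X σ : MvPolynomial S E) ≤ if σ = τ then 1 else 0 := by
        refine (degreeOf_add_le τ _ _).trans (max_le ?_ ?_)
        · simp [degreeOf_one]
        · rw [degreeOf_X]; simp [eq_comm]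
      refine (Nat.mul_le_mul_left _ h1).trans ?_
      split_ifs <;> simp
    refine (Finset.sum_le_sum h).trans ?_
    simp
  · refine (isBigO_zero _ _).congr_left fun y => ?_
    simp [map_prod]

/-- truncation of a local expansion to total degree `≤ N` -/
lemma isBigO_eval_sub_truncation (hemb : ∀ (σ : S) (z : F), ‖emb σ z‖ = ‖z‖)
    (P : MvPolynomial S E) :
    (fun y : F => eval (fun σ => emb σ y) P -
      ∑ j ∈ degLE S N, coeff (Finsupp.equivFunOnFinite.symm j) P * mPow emb y j)
      =O[𝓝 0] fun y : F => ‖y‖ ^ (N + 1) := by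
  induction P using MvPolynomial.induction_on' with
  | add p q hp hq =>
    refine (hp.add hq).congr_left fun y => ?_
    simp only [map_add, coeff_add, add_mul, Finset.sum_add_distrib]
    ring
  | monomial m a =>
    have heval : ∀ y : F, eval (fun σ => emb σ y) (monomial m a) = a * mPow emb y m := by
      intro y
      rw [eval_monomial, Finsupp.prod_fintype _ _ (by simp)]
      rfl
    have hcoeff : ∀ j : S → ℕ, coeff (Finsupp.equivFunOnFinite.symm j) (monomial m a)
        = if (m : S → ℕ) = j then a else 0 := by
      intro j
      rw [coeff_monomial]
      congr 1
      rw [Equiv.eq_symm_apply]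
      rfl
    simp only [heval, hcoeff, ite_mul, zero_mul, Finset.sum_ite_eq]
    by_cases hm : (m : S → ℕ) ∈ degLE S N
    · simp only [hm, if_true, sub_self]
      exact isBigO_zero _ _
    · simp only [hm, if_false, sub_zero]
      have hN : N + 1 ≤ mSum (m : S → ℕ) := by
        rw [mem_degLE] at hm; omega
      refine IsBigO.trans ?_ (isBigO_pow_norm hN)
      refine IsBigO.const_mul_left ?_ a
      exact IsBigO.of_bound 1 (Eventually.of_forall fun y => by simp [norm_mPow hemb])

lemma HasJetOne.exists_coeff (hemb : ∀ (σ : S) (z : F), ‖emb σ z‖ = ‖z‖)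
    (hf : HasJetOne emb N J b f) :
    ∃ c : (S → ℕ) → E, (∀ j σ, σ ∉ J → b σ < j σ → c j = 0) ∧
      (fun y : F => f (1 + y) - ∑ j ∈ degLE S N, c j * mPow emb y j)
        =O[𝓝 0] fun y : F => ‖y‖ ^ (N + 1) := by
  obtain ⟨P, hd, hP⟩ := hf
  refine ⟨fun j => coeff (Finsupp.equivFunOnFinite.symm j) P, fun j σ hσ hj => ?_, ?_⟩
  · rw [← notMem_support_iff]
    exact notMem_support_of_degreeOf_lt σ ((hd σ hσ).trans_lt hj)
  · refine (hP.add (isBigO_eval_sub_truncation hemb P)).congr_left fun y => ?_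
    ring

lemma norm_sub_sum_le_of_hasSum [IsUltrametricDist E] {ι : Type*} {u : ι → E} {a : E}
    (h : HasSum u a) (T : Finset ι) {B : ℝ} (hB : 0 ≤ B) (hu : ∀ i, i ∉ T → ‖u i‖ ≤ B) :
    ‖a - ∑ i ∈ T, u i‖ ≤ B := by
  have hlim : Tendsto (fun A : Finset ι => ‖∑ i ∈ A, u i - ∑ i ∈ T, u i‖) atTop
      (𝓝 ‖a - ∑ i ∈ T, u i‖) := (Tendsto.sub_const h _).norm
  refine le_of_tendsto hlim ((eventually_ge_atTop T).mono fun A hA => ?_)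
  rw [← Finset.sum_sdiff hA, add_sub_cancel_right]
  exact IsUltrametricDist.norm_sum_le_of_forall_le_of_nonneg hB fun i hi =>
    hu i (Finset.mem_sdiff.mp hi).2

/-- locally `J`-analytic characters have local expansions -/
lemma IsLocJChar.hasJetOne [IsUltrametricDist E] {q : ℕ} (hq : 1 < q) {ϖ : F}
    (hϖ : ‖ϖ‖ = (q : ℝ)⁻¹) (hemb : ∀ (σ : S) (z : F), ‖emb σ z‖ = ‖z‖) {χ : F →* E}
    (hχ : IsLocJChar q emb J χ) : HasJetOne emb N J 0 χ := by
  obtain ⟨-, l, hl⟩ := hχ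
  obtain ⟨c, hc0, hc⟩ := hl 1 norm_one
  have hq0 : (0 : ℝ) < q := by exact_mod_cast (by omega : 0 < q)
  set ρ : ℝ := (q : ℝ) ^ (-(l : ℤ)) with hρ
  have hρ0 : 0 < ρ := zpow_pos hq0 _
  have hϖl : ‖ϖ ^ l‖ = ρ := by
    rw [norm_pow, hϖ, hρ, zpow_neg, zpow_natCast, inv_pow]
  obtain ⟨C, hC⟩ : ∃ C : ℝ, ∀ m : S → ℕ, ‖c m‖ * ρ ^ mSum m ≤ C := by
    have hs := (hc (1 + ϖ ^ l) (by rw [add_sub_cancel_left, hϖl])).summable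
    have ht := hs.tendsto_cofinite_zero.norm
    rw [norm_zero] at ht
    obtain ⟨C, hC⟩ := ht.bddAbove_range_of_cofinite
    refine ⟨C, fun m => ?_⟩
    have := hC ⟨m, rfl⟩
    simpa [norm_mPow hemb, hϖ, hρ] using this
  have hC0 : 0 ≤ C := le_trans (by positivity) (hC 0)
  refine ⟨∑ j ∈ degLE S N, monomial (Finsupp.equivFunOnFinite.symm j) (c j),
    fun σ hσ => ?_, ?_⟩
  · refine (degreeOf_sum_le σ _ _).trans (Finset.sup_le fun j _ => ?_)
    by_cases hj : c j = 0
    · simp [hj]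
    · rw [degreeOf_monomial_eq _ _ hj]
      by_contra hne
      refine hj (hc0 j fun h => hne ?_)
      simp [h σ hσ]
  · refine IsBigO.of_bound (C / ρ ^ (N + 1)) ?_
    filter_upwards [Metric.closedBall_mem_nhds (0 : F) hρ0] with y hy
    rw [mem_closedBall_zero_iff] at hy
    have heval : eval (fun σ => emb σ y)
        (∑ j ∈ degLE S N, monomial (Finsupp.equivFunOnFinite.symm j) (c j))
        = ∑ j ∈ degLE S N, c j * mPow emb y j := by
      rw [map_sum]
      refine Finset.sum_congr rfl fun j _ => ?_
      rw [eval_monomial, Finsupp.prod_fintype _ _ (by simp)]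
      rfl
    have hsum := hc (1 + y) (by rwa [add_sub_cancel_left])
    rw [add_sub_cancel_left] at hsum
    rw [heval]
    refine (norm_sub_sum_le_of_hasSum hsum (degLE S N)
      (B := C / ρ ^ (N + 1) * ‖y‖ ^ (N + 1)) (by positivity) fun m hm => ?_).trans (by simp)
    have hN : N + 1 ≤ mSum m := by rw [mem_degLE] at hm; omega
    rw [norm_mul, norm_mPow hemb]
    calc ‖c m‖ * ‖y‖ ^ mSum m = ‖c m‖ * ρ ^ mSum m * (‖y‖ / ρ) ^ mSum m := by
          rw [div_pow]; field_simp
      _ ≤ C * (‖y‖ / ρ) ^ (N + 1) := by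
          refine mul_le_mul (hC m) ?_ (by positivity) hC0
          exact pow_le_pow_of_le_one (by positivity) ((div_le_one hρ0).mpr hy) hN
      _ = C / ρ ^ (N + 1) * ‖y‖ ^ (N + 1) := by rw [div_pow]; ring

end Jets

/-! ### Criteria for being of class `C^r` -/

lemma charZero_of_norm_natCast_lt_one [IsUltrametricDist E] {p : ℕ}
    (h0 : 0 < ‖(p : E)‖) (h1 : ‖(p : E)‖ < 1) : CharZero E := by
  rcases CharP.exists E with ⟨c, hc⟩
  rcases CharP.char_is_prime_or_zero E c with hprime | rfl
  · exfalso
    have hp0 : (p : E) ≠ 0 := norm_pos_iff.mp h0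
    have hcop : Nat.Coprime p c := by
      rw [Nat.coprime_comm, hprime.coprime_iff_not_dvd]
      exact fun h => hp0 ((CharP.cast_eq_zero_iff E c p).mpr h)
    have hone : ((p ^ c.totient : ℕ) : E) = ((1 : ℕ) : E) :=
      (CharP.natCast_eq_natCast E c).mpr (Nat.ModEq.pow_totient hcop)
    have hn := congrArg norm hone
    rw [Nat.cast_pow, norm_pow, Nat.cast_one, norm_one] at hn
    exact (pow_lt_one₀ h0.le h1 (Nat.totient_pos.mpr hprime.pos).ne').ne hn
  · exact CharP.charP_to_charZero E

lemma mFact_cast_ne_zero [CharZero E] (i : S → ℕ) : (mFact i : E) ≠ 0 := by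
  rw [Nat.cast_ne_zero, mFact]
  exact Finset.prod_ne_zero_iff.mpr fun σ _ => Nat.factorial_ne_zero _

section Criteria

variable {q : ℕ} {emb : S → (F →+* E)} {r : ℝ} {J : Set S} {d : S → ℕ}

/-- A function with bounded Taylor coefficients and remainder `O(‖y‖^t)`, `t > r`, is of
class `C^r`. -/
lemma isCrJ_of_taylor [CharZero E] (hq : 1 < q) {f : F → E} (c : (S → ℕ) → F → E) {t : ℝ}
    (ht0 : 0 ≤ t) (ht : r < t)
    (hbound : ∀ j, mSum j ≤ ⌊r⌋₊ → ∃ C : ℝ, ∀ x : F, ‖x‖ ≤ 1 → ‖c j x‖ ≤ C)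
    (hrem : ∃ C : ℝ, ∀ x y : F, ‖x‖ ≤ 1 → ‖y‖ ≤ 1 →
      ‖f (x + y) - ∑ j ∈ degLE S ⌊r⌋₊, c j x * mPow emb y j‖ ≤ C * ‖y‖ ^ t)
    (hdeg : ∀ j σ, σ ∉ J → d σ < j σ → ∀ x, c j x = 0) : IsCrJ q emb r J d f := by
  have hq1 : (1 : ℝ) < q := by exact_mod_cast hq
  have hq0 : (0 : ℝ) < q := by linarith
  refine ⟨fun j x => c j x * (mFact j : E), ⟨fun j hj => ?_, fun ε hε => ?_⟩, ?_⟩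
  · obtain ⟨C, hC⟩ := hbound j hj
    refine ⟨C * ‖(mFact j : E)‖, fun x hx => ?_⟩
    rw [norm_mul]
    exact mul_le_mul_of_nonneg_right (hC x hx) (norm_nonneg _)
  · obtain ⟨C, hC⟩ := hrem
    have hlim : Tendsto (fun h : ℕ => |C| * ((q : ℝ) ^ (r - t)) ^ h) atTop (𝓝 0) := by
      simpa using (tendsto_pow_atTop_nhds_zero_of_lt_one (by positivity)
        (Real.rpow_lt_one_of_one_lt_of_neg hq1 (by linarith))).const_mul |C|
    obtain ⟨H, hH⟩ := eventually_atTop.mp (hlim.eventually (ge_mem_nhds hε))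
    refine ⟨H, fun h hh x y hx hy => le_trans ?_ (hH h hh)⟩
    have hy1 : ‖y‖ ≤ 1 := hy.trans (by
      rw [zpow_neg, zpow_natCast]
      exact inv_le_one_of_one_le₀ (one_le_pow₀ hq1.le))
    have hrem' : ‖crRem emb ⌊r⌋₊ f (fun j x => c j x * (mFact j : E)) x y‖ ≤ C * ‖y‖ ^ t := by
      refine le_trans (le_of_eq ?_) (hC x y hx hy1)
      unfold crRem
      congr 2
      refine Finset.sum_congr rfl fun j _ => ?_
      have := mFact_cast_ne_zero (E := E) j
      field_simp
    have hyt : ‖y‖ ^ t ≤ ((q : ℝ) ^ (-(h : ℝ))) ^ t := by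
      refine Real.rpow_le_rpow (norm_nonneg _) (hy.trans (le_of_eq ?_)) ht0
      rw [← Real.rpow_intCast]; push_cast; rfl
    calc _ ≤ |C| * ((q : ℝ) ^ (-(h : ℝ))) ^ t * (q : ℝ) ^ (r * (h : ℝ)) := by
          refine mul_le_mul_of_nonneg_right (hrem'.trans ?_) (by positivity)
          exact mul_le_mul (le_abs_self C) hyt (by positivity) (abs_nonneg C)
      _ = |C| * ((q : ℝ) ^ (r - t)) ^ h := by
          rw [mul_assoc, ← Real.rpow_mul hq0.le, ← Real.rpow_add hq0, ← Real.rpow_natCast,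
            ← Real.rpow_mul hq0.le]
          congr 2; ring
  · intro σ hσ x _
    simp only [hdeg _ σ hσ (by simp : d σ < (Pi.single σ (d σ + 1) : S → ℕ) σ) x, zero_mul]

lemma isCrJ_zero : IsCrJ q emb r J d (fun _ : F => (0 : E)) := by
  refine ⟨fun _ _ => 0, ⟨fun _ _ => ⟨0, fun _ _ => by simp⟩, fun ε hε => ⟨0, ?_⟩⟩, ?_⟩
  · intro h _ x y _ _
    simpa [crRem] using hε.le
  · simp

lemma IsCrJ.add {f g : F → E} (hf : IsCrJ q emb r J d f) (hg : IsCrJ q emb r J d g) :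
    IsCrJ q emb r J d (fun z => f z + g z) := by
  obtain ⟨Df, ⟨hfb, hfr⟩, hfd⟩ := hf
  obtain ⟨Dg, ⟨hgb, hgr⟩, hgd⟩ := hg
  refine ⟨fun j x => Df j x + Dg j x, ⟨fun j hj => ?_, fun ε hε => ?_⟩, ?_⟩
  · obtain ⟨C, hC⟩ := hfb j hj
    obtain ⟨C', hC'⟩ := hgb j hj
    exact ⟨C + C', fun x hx => (norm_add_le _ _).trans (add_le_add (hC x hx) (hC' x hx))⟩
  · obtain ⟨H, hH⟩ := hfr (ε / 2) (by linarith)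
    obtain ⟨H', hH'⟩ := hgr (ε / 2) (by linarith)
    refine ⟨max H H', fun h hh x y hx hy => ?_⟩
    have h1 := hH h (le_trans (le_max_left _ _) hh) x y hx hy
    have h2 := hH' h (le_trans (le_max_right _ _) hh) x y hx hy
    have heq : crRem emb ⌊r⌋₊ (fun z => f z + g z) (fun j x => Df j x + Dg j x) x y
        = crRem emb ⌊r⌋₊ f Df x y + crRem emb ⌊r⌋₊ g Dg x y := by
      simp only [crRem, add_mul, add_div, Finset.sum_add_distrib]
      ring
    rw [heq]
    have h3 := mul_le_mul_of_nonneg_right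
      (norm_add_le (crRem emb ⌊r⌋₊ f Df x y) (crRem emb ⌊r⌋₊ g Dg x y))
      (by positivity : (0 : ℝ) ≤ (q : ℝ) ^ (r * (h : ℝ)))
    linarith
  · intro σ hσ x hx
    simp only [hfd σ hσ x hx, hgd σ hσ x hx, add_zero]

lemma IsCrJ.const_mul {f : F → E} (a : E) (hf : IsCrJ q emb r J d f) :
    IsCrJ q emb r J d (fun z => a * f z) := by
  obtain ⟨Df, ⟨hfb, hfr⟩, hfd⟩ := hf
  refine ⟨fun j x => a * Df j x, ⟨fun j hj => ?_, fun ε hε => ?_⟩, ?_⟩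
  · obtain ⟨C, hC⟩ := hfb j hj
    refine ⟨‖a‖ * C, fun x hx => ?_⟩
    rw [norm_mul]
    exact mul_le_mul_of_nonneg_left (hC x hx) (norm_nonneg _)
  · obtain ⟨H, hH⟩ := hfr (ε / (‖a‖ + 1)) (by positivity)
    refine ⟨H, fun h hh x y hx hy => ?_⟩
    have h1 := hH h hh x y hx hy
    have heq : crRem emb ⌊r⌋₊ (fun z => a * f z) (fun j x => a * Df j x) x y
        = a * crRem emb ⌊r⌋₊ f Df x y := by
      simp only [crRem, mul_sub, Finset.mul_sum]
      congr 1
      exact Finset.sum_congr rfl fun j _ => by ring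
    rw [heq, norm_mul, mul_assoc]
    have h2 : 0 ≤ ‖crRem emb ⌊r⌋₊ f Df x y‖ * (q : ℝ) ^ (r * (h : ℝ)) := by positivity
    rw [le_div_iff₀ (by positivity)] at h1
    nlinarith
  · intro σ hσ x hx
    simp only [hfd σ hσ x hx, mul_zero]

lemma IsCrJ.sum {ι : Type*} (T : Finset ι) {f : ι → F → E}
    (hf : ∀ i ∈ T, IsCrJ q emb r J d (f i)) : IsCrJ q emb r J d (fun z => ∑ i ∈ T, f i z) := by
  induction T using Finset.induction_on with
  | empty => simpa using isCrJ_zero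
  | insert i T hi ih =>
    simp only [Finset.sum_insert hi]
    exact (hf i (Finset.mem_insert_self i T)).add
      (ih fun k hk => hf k (Finset.mem_insert_of_mem hk))

/-- polynomial functions of degree `≤ d` off `J` -/
lemma isCrJ_mPow [CharZero E] (hq : 1 < q)
    (hemb : ∀ (σ : S) (z : F), ‖emb σ z‖ = ‖z‖) (hr : 0 ≤ r) {i : S → ℕ}
    (hid : ∀ σ, σ ∉ J → i σ ≤ d σ) (hir : mSum i ≤ ⌊r⌋₊) :
    IsCrJ q emb r J d (fun z : F => mPow emb z i) := by
  have hmem : ∀ k : S → ℕ, k ∈ Fintype.piFinset (fun σ => Finset.range (i σ + 1)) ↔ k ≤ i := by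
    intro k
    simp [Fintype.mem_piFinset, Pi.le_def]
  refine isCrJ_of_taylor hq (t := r + 1)
    (fun k x => if k ≤ i then (∏ σ, ((i σ).choose (k σ) : E)) *
      mPow emb x (fun σ => i σ - k σ) else 0) (by linarith) (by linarith)
    (fun j _ => ?_) ⟨0, fun x y _ _ => ?_⟩ ?_
  · refine ⟨‖(∏ σ, ((i σ).choose (j σ) : E))‖, fun x hx => ?_⟩
    split_ifs
    · rw [norm_mul, norm_mPow hemb]
      exact mul_le_of_le_one_right (norm_nonneg _) (pow_le_one₀ (norm_nonneg _) hx)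
    · rw [norm_zero]
      exact norm_nonneg _
  · rw [mPow_add, zero_mul, norm_le_zero_iff, sub_eq_zero]
    have hsub : Fintype.piFinset (fun σ => Finset.range (i σ + 1)) ⊆ degLE S ⌊r⌋₊ := by
      intro k hk
      rw [mem_degLE]
      exact (Finset.sum_le_sum fun σ _ => (hmem k).mp hk σ).trans hir
    rw [← Finset.sum_subset hsub]
    · refine Finset.sum_congr rfl fun k hk => ?_
      rw [if_pos ((hmem k).mp hk)]
    · intro k _ hk
      rw [if_neg fun h => hk ((hmem k).mpr h), zero_mul]
  · intro j σ hσ hj x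
    refine if_neg fun h => ?_
    exact absurd ((h σ).trans (hid σ hσ)) hj.not_ge

end Criteria

/-! ### Multiplicative functions -/

section Characters

variable {q : ℕ} {emb : S → (F →+* E)} {r s : ℝ} {J : Set S} {d : S → ℕ} {φ : F →*₀ E}

/-- uniform Taylor estimate for a multiplicative function with `‖φ z‖ = ‖z‖^s` -/
lemma exists_norm_taylor_le (hemb : ∀ (σ : S) (z : F), ‖emb σ z‖ = ‖z‖) {N : ℕ} {t : ℝ}
    (ht0 : 0 < t) (hts : t ≤ s) (htN : t ≤ N + 1) (hNs : (N : ℝ) ≤ s)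
    (hnorm : ∀ z, ‖φ z‖ = ‖z‖ ^ s) {c : (S → ℕ) → E}
    (hc : (fun y : F => φ (1 + y) - ∑ j ∈ degLE S N, c j * mPow emb y j)
      =O[𝓝 0] fun y : F => ‖y‖ ^ (N + 1)) {M : ℝ} (hM : 0 ≤ M) :
    ∃ K : ℝ, 0 ≤ K ∧ ∀ w v : F, ‖w‖ ≤ M → ‖v‖ ≤ M →
      ‖φ (w + v) - ∑ j ∈ degLE S N, φ w * c j * mPow emb (v / w) j‖ ≤ K * ‖v‖ ^ t := by
  have hs0 : 0 < s := ht0.trans_le hts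
  obtain ⟨C, hC0, hC⟩ := hc.exists_pos
  rw [Asymptotics.isBigOWith_iff] at hC
  obtain ⟨δ', hδ'0, hδ'⟩ := Metric.eventually_nhds_iff.mp hC
  obtain ⟨δ, hδ0, hδ1, hδ⟩ : ∃ δ : ℝ, 0 < δ ∧ δ ≤ 1 ∧ ∀ y : F, ‖y‖ < δ →
      ‖φ (1 + y) - ∑ j ∈ degLE S N, c j * mPow emb y j‖ ≤ C * ‖y‖ ^ (N + 1) := by
    refine ⟨min δ' 1, by positivity, min_le_right _ _, fun y hy => ?_⟩
    have := hδ' (y := y) (by simpa using hy.trans_le (min_le_left _ _))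
    simpa using this
  have hMt : ∀ w : F, ‖w‖ ≤ M → ‖w‖ ^ (s - t) ≤ M ^ (s - t) := fun w hw =>
    Real.rpow_le_rpow (norm_nonneg w) hw (by linarith)
  have hMt0 : 0 ≤ M ^ (s - t) := by positivity
  have hpow : ∀ v : F, ‖v‖ ≤ M → ‖v‖ ^ s ≤ M ^ (s - t) * ‖v‖ ^ t := by
    intro v hv
    rcases (norm_nonneg v).eq_or_lt with h0 | h0
    · rw [← h0, Real.zero_rpow hs0.ne', Real.zero_rpow ht0.ne', mul_zero]
    · calc ‖v‖ ^ s = ‖v‖ ^ (s - t) * ‖v‖ ^ t := by rw [← Real.rpow_add h0, sub_add_cancel]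
        _ ≤ _ := mul_le_mul_of_nonneg_right (hMt v hv) (by positivity)
  set B : ℝ := (δ⁻¹ + 1) ^ s + ∑ j ∈ degLE S N, ‖c j‖ * δ⁻¹ ^ s with hB
  have hB0 : 0 ≤ B := by positivity
  refine ⟨C * M ^ (s - t) + B * M ^ (s - t), by positivity, fun w v hw hv => ?_⟩
  have hvt : 0 ≤ ‖v‖ ^ t := by positivity
  rcases lt_or_ge ‖v‖ (δ * ‖w‖) with hlt | hge
  · have hw0 : 0 < ‖w‖ := by
      rcases (norm_nonneg w).eq_or_lt with h0 | h0
      · rw [← h0, mul_zero] at hlt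
        exact absurd hlt (norm_nonneg v).not_gt
      · exact h0
    have hwne : w ≠ 0 := norm_pos_iff.mp hw0
    have hu : ‖v / w‖ < δ := by rwa [norm_div, div_lt_iff₀ hw0]
    have heq : φ (w + v) - ∑ j ∈ degLE S N, φ w * c j * mPow emb (v / w) j
        = φ w * (φ (1 + v / w) - ∑ j ∈ degLE S N, c j * mPow emb (v / w) j) := by
      have hwu : w * (1 + v / w) = w + v := by field_simp
      rw [mul_sub, ← map_mul, hwu, Finset.mul_sum]
      simp only [mul_assoc]
    have hu1 : ‖v / w‖ ^ (N + 1) ≤ ‖v / w‖ ^ t := by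
      rw [← Real.rpow_natCast]
      exact Real.rpow_le_rpow_of_exponent_ge' (norm_nonneg _) (hu.le.trans hδ1) ht0.le
        (by push_cast; exact htN)
    calc _ = ‖w‖ ^ s * ‖φ (1 + v / w) - ∑ j ∈ degLE S N, c j * mPow emb (v / w) j‖ := by
          rw [heq, norm_mul, hnorm]
      _ ≤ ‖w‖ ^ s * (C * ‖v / w‖ ^ t) := by
          refine mul_le_mul_of_nonneg_left ((hδ _ hu).trans ?_) (by positivity)
          exact mul_le_mul_of_nonneg_left hu1 hC0.le
      _ = C * ‖w‖ ^ (s - t) * ‖v‖ ^ t := by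
          rw [norm_div, Real.div_rpow (norm_nonneg _) (norm_nonneg _), Real.rpow_sub hw0]
          ring
      _ ≤ C * M ^ (s - t) * ‖v‖ ^ t := by
          have := hMt w hw
          gcongr
      _ ≤ _ := by
          rw [add_mul]
          exact le_add_of_nonneg_right (by positivity)
  · have hwv : ‖w‖ ≤ δ⁻¹ * ‖v‖ := by
      rw [inv_mul_eq_div, le_div_iff₀ hδ0]; linarith
    have hterm : ∀ j ∈ degLE S N, ‖φ w * c j * mPow emb (v / w) j‖
        ≤ ‖c j‖ * δ⁻¹ ^ s * ‖v‖ ^ s := by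
      intro j hj
      rw [mem_degLE] at hj
      rcases (norm_nonneg w).eq_or_lt with h0 | h0
      · rw [norm_eq_zero.mp h0.symm, map_zero]
        simp only [zero_mul, norm_zero]
        positivity
      · have h1 : 1 ≤ δ⁻¹ * ‖v‖ / ‖w‖ := (one_le_div h0).mpr hwv
        have h2 : ‖v / w‖ ^ mSum j ≤ (δ⁻¹ * ‖v‖ / ‖w‖) ^ s := by
          calc ‖v / w‖ ^ mSum j ≤ (δ⁻¹ * ‖v‖ / ‖w‖) ^ mSum j := by
                refine pow_le_pow_left₀ (norm_nonneg _) ?_ _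
                rw [norm_div]
                gcongr
                exact le_mul_of_one_le_left (norm_nonneg _) ((one_le_inv₀ hδ0).mpr hδ1)
            _ ≤ (δ⁻¹ * ‖v‖ / ‖w‖) ^ s := by
                rw [← Real.rpow_natCast]
                exact Real.rpow_le_rpow_of_exponent_le h1
                  (le_trans (by exact_mod_cast hj) hNs)
        rw [norm_mul, norm_mul, hnorm, norm_mPow hemb]
        calc ‖w‖ ^ s * ‖c j‖ * ‖v / w‖ ^ mSum j
            ≤ ‖w‖ ^ s * ‖c j‖ * (δ⁻¹ * ‖v‖ / ‖w‖) ^ s := by gcongr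
          _ = ‖c j‖ * δ⁻¹ ^ s * ‖v‖ ^ s := by
              rw [Real.div_rpow (by positivity) h0.le, Real.mul_rpow (by positivity)
                (norm_nonneg v)]
              have : ‖w‖ ^ s ≠ 0 := (Real.rpow_pos_of_pos h0 s).ne'
              field_simp
    have hmain : ‖φ (w + v)‖ ≤ (δ⁻¹ + 1) ^ s * ‖v‖ ^ s := by
      rw [hnorm, ← Real.mul_rpow (by positivity) (norm_nonneg v)]
      refine Real.rpow_le_rpow (norm_nonneg _) ((norm_add_le w v).trans ?_) hs0.le
      linarith
    calc _ ≤ (δ⁻¹ + 1) ^ s * ‖v‖ ^ s + ∑ j ∈ degLE S N, ‖c j‖ * δ⁻¹ ^ s * ‖v‖ ^ s :=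
          (norm_sub_le _ _).trans (add_le_add hmain (norm_sum_le_of_le _ hterm))
      _ = B * ‖v‖ ^ s := by rw [hB, add_mul, Finset.sum_mul]
      _ ≤ B * (M ^ (s - t) * ‖v‖ ^ t) := mul_le_mul_of_nonneg_left (hpow v hv) hB0
      _ ≤ _ := by
          rw [add_mul (C * _), mul_assoc B]
          exact le_add_of_nonneg_left (by positivity)

/-- A multiplicative function with `‖φ z‖ = ‖z‖^s`, `s > r`, which has local expansions
at `1` is of class `C^r` after any affine change of variables. -/
lemma isCrJ_comp_affine [CharZero E] (hq : 1 < q)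
    (hemb : ∀ (σ : S) (z : F), ‖emb σ z‖ = ‖z‖) (hr : 0 ≤ r) (hs : r < s)
    (hnorm : ∀ z, ‖φ z‖ = ‖z‖ ^ s) (hφ : HasJetOne emb ⌊r⌋₊ J d φ) (b a : F) :
    IsCrJ q emb r J d (fun z => φ (b + a * z)) := by
  obtain ⟨c, hc0, hc⟩ := hφ.exists_coeff hemb
  have hN : (⌊r⌋₊ : ℝ) ≤ r := Nat.floor_le hr
  have hN1 : r < (⌊r⌋₊ : ℝ) + 1 := Nat.lt_floor_add_one r
  set t := min s ((⌊r⌋₊ : ℝ) + 1) with ht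
  have hrt : r < t := lt_min hs hN1
  have hM : 0 ≤ ‖b‖ + ‖a‖ := by positivity
  obtain ⟨K, hK0, hK⟩ := exists_norm_taylor_le hemb (hr.trans_lt hrt) (min_le_left _ _)
    (min_le_right _ _) (hN.trans hs.le) hnorm hc hM
  have hw : ∀ x : F, ‖x‖ ≤ 1 → ‖a * x‖ ≤ ‖a‖ := fun x hx => by
    rw [norm_mul]; exact mul_le_of_le_one_right (norm_nonneg a) hx
  have hw' : ∀ x : F, ‖x‖ ≤ 1 → ‖b + a * x‖ ≤ ‖b‖ + ‖a‖ := fun x hx =>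
    (norm_add_le _ _).trans (add_le_add le_rfl (hw x hx))
  refine isCrJ_of_taylor hq (t := t)
    (fun j x => φ (b + a * x) * c j * mPow emb (a / (b + a * x)) j)
    (hr.trans hrt.le) hrt (fun j hj => ?_) ⟨K * ‖a‖ ^ t, fun x y hx hy => ?_⟩
    (fun j σ hσ hj x => by simp [hc0 j σ hσ hj])
  · refine ⟨‖c j‖ * ‖a‖ ^ mSum j * (‖b‖ + ‖a‖) ^ (s - mSum j), fun x hx => ?_⟩
    have hjs : (0 : ℝ) ≤ s - mSum j := by
      have : (mSum j : ℝ) ≤ ⌊r⌋₊ := by exact_mod_cast hj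
      linarith
    rcases (norm_nonneg (b + a * x)).eq_or_lt with h0 | h0
    · rw [norm_eq_zero.mp h0.symm, map_zero]
      simp only [zero_mul, norm_zero]
      positivity
    · rw [norm_mul, norm_mul, hnorm, norm_mPow hemb, norm_div, div_pow]
      calc _ = ‖c j‖ * ‖a‖ ^ mSum j * ‖b + a * x‖ ^ (s - mSum j) := by
            rw [Real.rpow_sub h0, Real.rpow_natCast]; ring
        _ ≤ _ := by
            have := Real.rpow_le_rpow h0.le (hw' x hx) hjs
            gcongr
  · have h := hK (b + a * x) (a * y) (hw' x hx)
      ((hw y hy).trans (le_add_of_nonneg_left (norm_nonneg b)))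
    rw [norm_mul, Real.mul_rpow (norm_nonneg a) (norm_nonneg y), ← mul_assoc] at h
    refine le_trans (le_of_eq ?_) h
    congr 2
    · congr 1; ring
    · refine Finset.sum_congr rfl fun j _ => ?_
      rw [mul_div_right_comm a y, mPow_mul_base]
      ring

end Characters

section Quotients

variable {q : ℕ} {emb : S → (F →+* E)} {J : Set S}

/-- a multiplicative function which is bounded near `1` has norm `1` on units -/
lemma norm_map_eq_one_of_norm_eq_one [IsUltrametricDist F] (hq : 1 < q)
    (hres : ∀ (a : F) (n : ℤ), ∃ R : Finset F, R.card = q ∧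
      (∀ x ∈ R, ‖x - a‖ ≤ (q : ℝ) ^ (-n)) ∧
      ∀ z : F, ‖z - a‖ ≤ (q : ℝ) ^ (-n) → ∃! x, x ∈ R ∧ ‖z - x‖ ≤ (q : ℝ) ^ (-(n + 1)))
    {φ : F →*₀ E} (hφ : (fun y : F => φ (1 + y)) =O[𝓝 0] fun _ : F => (1 : ℝ))
    {u : F} (hu : ‖u‖ = 1) : ‖φ u‖ = 1 := by
  have hq1 : (1 : ℝ) < q := by exact_mod_cast hq
  have hq0 : (0 : ℝ) < q := by linarith
  obtain ⟨C, hC0, hC⟩ := hφ.exists_pos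
  rw [Asymptotics.isBigOWith_iff] at hC
  obtain ⟨δ, hδ0, hδ⟩ := Metric.eventually_nhds_iff.mp hC
  obtain ⟨L, hL⟩ : ∃ L : ℕ, (q : ℝ) ^ (-(L : ℤ)) < δ := by
    obtain ⟨L, hL⟩ := exists_pow_lt_of_lt_one hδ0 (inv_lt_one_of_one_lt₀ hq1)
    exact ⟨L, by rwa [zpow_neg, zpow_natCast, ← inv_pow]⟩
  have hball : ∀ k : ℕ, ∀ a : F, ∃ K : ℝ, ∀ z : F, ‖z‖ = 1 →
      ‖z - a‖ ≤ (q : ℝ) ^ (-((L : ℤ) - k)) → ‖φ z‖ ≤ K := by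
    intro k
    induction k with
    | zero =>
      intro a
      by_cases h : ∃ z₀ : F, ‖z₀‖ = 1 ∧ ‖z₀ - a‖ ≤ (q : ℝ) ^ (-(L : ℤ))
      · obtain ⟨z₀, hz₀, hz₀a⟩ := h
        refine ⟨C * ‖φ z₀‖, fun z hz hza => ?_⟩
        simp only [Nat.cast_zero, sub_zero] at hza
        have hz₀ne : z₀ ≠ 0 := norm_pos_iff.mp (by rw [hz₀]; exact one_pos)
        have hd : ‖z - z₀‖ ≤ (q : ℝ) ^ (-(L : ℤ)) := by
          rw [← sub_sub_sub_cancel_right z z₀ a]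
          rw [sub_eq_add_neg (z - a)]
          exact (IsUltrametricDist.norm_add_le_max _ _).trans
            (max_le hza (by rwa [norm_neg]))
        have h1 := hδ (y := (z - z₀) / z₀) (by
          rw [dist_zero_right, norm_div, hz₀, div_one]; exact hd.trans_lt hL)
        have h2 : z = (1 + (z - z₀) / z₀) * z₀ := by field_simp; ring
        rw [h2, map_mul, norm_mul]
        refine mul_le_mul_of_nonneg_right ?_ (norm_nonneg _)
        simpa using h1
      · refine ⟨0, fun z hz hza => absurd ⟨z, hz, by simpa using hza⟩ h⟩
    | succ k ih =>
      intro a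
      obtain ⟨R, -, -, hR⟩ := hres a ((L : ℤ) - (k + 1 : ℕ))
      choose K hK using ih
      refine ⟨∑ x ∈ R, |K x|, fun z hz hza => ?_⟩
      obtain ⟨x, ⟨hxR, hzx⟩, -⟩ := hR z hza
      refine (hK x z hz (hzx.trans (le_of_eq ?_))).trans ((le_abs_self _).trans ?_)
      · congr 1; push_cast; ring
      · exact Finset.single_le_sum (f := fun x => |K x|) (fun _ _ => abs_nonneg _) hxR
  obtain ⟨K, hK⟩ := hball L 0
  have hle : ∀ v : F, ‖v‖ = 1 → ‖φ v‖ ≤ 1 := by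
    intro v hv
    by_contra! hlt
    obtain ⟨n, hn⟩ := pow_unbounded_of_one_lt K hlt
    have := hK (v ^ n) (by simp [hv]) (by simp [hv])
    rw [map_pow, norm_pow] at this
    linarith
  have hune : u ≠ 0 := norm_pos_iff.mp (by rw [hu]; exact one_pos)
  have hinv := hle u⁻¹ (by rw [norm_inv, hu, inv_one])
  rw [map_inv₀, norm_inv] at hinv
  refine le_antisymm (hle u hu) ((inv_le_one₀ (norm_pos_iff.mpr ?_)).mp hinv)
  exact (map_ne_zero φ).mpr hune

/-- the growth of a multiplicative function is determined by its value at one non-unit -/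
lemma norm_map_eq_rpow {e : ℕ} (he : 0 < e) (hq : 1 < q)
    (hval : ∀ x : F, x ≠ 0 → ∃ n : ℤ, ‖x‖ = (q : ℝ) ^ n) {φ : F →*₀ E}
    (hunit : ∀ u : F, ‖u‖ = 1 → ‖φ u‖ = 1) {π : F} (hπ : ‖π‖ = (q : ℝ) ^ (-(e : ℤ)))
    {s : ℝ} (hs : 0 < s) (hφπ : ‖φ π‖ = ‖π‖ ^ s) (z : F) : ‖φ z‖ = ‖z‖ ^ s := by
  have hq0 : (0 : ℝ) < q := by exact_mod_cast (by omega : 0 < q)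
  rcases eq_or_ne z 0 with rfl | hz
  · rw [map_zero, norm_zero, norm_zero, Real.zero_rpow hs.ne']
  obtain ⟨n, hn⟩ := hval z hz
  have hprod : ‖z ^ e * π ^ n‖ = 1 := by
    rw [norm_mul, norm_pow, norm_zpow, hn, hπ, ← zpow_natCast, ← zpow_mul, ← zpow_mul,
      ← zpow_add₀ hq0.ne']
    ring_nf
    exact zpow_zero _
  have h1 := hunit _ hprod
  rw [map_mul, map_pow, map_zpow₀, norm_mul, norm_pow, norm_zpow, hφπ] at h1
  have h2 : (‖z‖ ^ s) ^ e * (‖π‖ ^ s) ^ n = 1 := by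
    rw [norm_mul, norm_pow, norm_zpow] at hprod
    rw [Real.rpow_pow_comm (norm_nonneg z), ← Real.rpow_intCast, ← Real.rpow_mul (norm_nonneg π),
      mul_comm s, Real.rpow_mul (norm_nonneg π), Real.rpow_intCast,
      ← Real.mul_rpow (by positivity) (by positivity), hprod, Real.one_rpow]
  have hπs : (‖π‖ ^ s) ^ n ≠ 0 := right_ne_zero_of_mul_eq_one h2
  exact (pow_left_inj₀ (norm_nonneg _) (by positivity) he.ne').mp
    (mul_right_cancel₀ hπs (h1.trans h2.symm))

/-- the quotient of two characters, extended by `0` -/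
def quotChar (A B : F →* E) : F →*₀ E where
  toFun z := if z = 0 then 0 else A z / B z
  map_zero' := if_pos rfl
  map_one' := by simp
  map_mul' x y := by
    by_cases hx : x = 0
    · simp [hx]
    by_cases hy : y = 0
    · simp [hy]
    simp [hx, hy, mul_div_mul_comm]

lemma quotChar_apply (A B : F →* E) (z : F) :
    quotChar A B z = if z = 0 then 0 else A z / B z := rfl

lemma hasJetOne_quotChar {N : ℕ} {b : S → ℕ} (hemb : ∀ (σ : S) (z : F), ‖emb σ z‖ = ‖z‖)
    {A B : F →* E} (hA : HasJetOne emb N J b A) (hB : HasJetOne emb N J 0 B) :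
    HasJetOne emb N J b (quotChar A B) := by
  refine ((hA.mul hemb (hB.inv hemb (map_one B))).mono subset_rfl
    (b' := b) fun σ _ => by simp).congr ?_
  have h : ContinuousAt (fun y : F => 1 + y) 0 := by fun_prop
  filter_upwards [h.eventually_ne (y := 0) (by simp)] with y hy
  rw [quotChar_apply, if_neg hy, div_eq_mul_inv]

lemma hasJetOne_monChar {N : ℕ} (T : Set S) (n : S → ℕ) :
    HasJetOne emb N J (fun σ => if σ ∈ T then n σ else 0) (monChar emb T n) := by
  have h := hasJetOne_prod (emb := emb) (N := N) (J := J)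
    (Finset.univ.filter fun σ => σ ∈ T) n
  simp only [Finset.mem_filter, Finset.mem_univ, true_and] at h
  exact h

lemma norm_monChar (hemb : ∀ (σ : S) (z : F), ‖emb σ z‖ = ‖z‖) (T : Set S) (n : S → ℕ) (z : F) :
    ‖monChar emb T n z‖ = ‖z‖ ^ ∑ σ, T.indicator n σ := by
  simp only [Set.indicator_apply, ← Finset.sum_filter, ← Finset.prod_pow_eq_pow_sum]
  simp [monChar, norm_prod, hemb]

lemma monChar_univ (k : S → ℕ) (z : F) : monChar emb Set.univ k z = mPow emb z k := by
  simp [monChar, mPow]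

lemma rpow_vP {p ef : ℕ} (hp : 1 < p) (hef : 0 < ef) {x : E} (hx : x ≠ 0) :
    ((p : ℝ) ^ (-(ef : ℤ))) ^ vP p ef x = ‖x‖ := by
  have hp1 : (1 : ℝ) < p := by exact_mod_cast hp
  have hef' : (ef : ℝ) ≠ 0 := by exact_mod_cast hef.ne'
  rw [← Real.rpow_intCast, ← Real.rpow_mul (by linarith)]
  have h : (((-(ef : ℤ) : ℤ)) : ℝ) * vP p ef x = Real.logb p ‖x‖ := by
    rw [vP]; push_cast; field_simp
  rw [h, Real.rpow_logb (by linarith) (by linarith) (norm_pos_iff.mpr hx)]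

end Quotients

section Generators

variable {emb : S → (F →+* E)} {J : Set S} {d i : S → ℕ} {χ1 χ2 : F →* E}

lemma monChar_not_mem (k : S → ℕ) (z : F) : monChar emb {σ | σ ∉ J} k z =
    ∏ σ ∈ Finset.univ.filter (fun σ => σ ∉ J), emb σ z ^ k σ := by
  refine Finset.prod_congr ?_ fun _ _ => rfl
  ext σ
  simp

/-- the character `z ↦ χ2χ1⁻¹(z) z^{d-i} z^{-i}`, extended by `0` -/
abbrev singChar (emb : S → (F →+* E)) (J : Set S) (d : S → ℕ) (χ1 χ2 : F →* E)
    (i : S → ℕ) : F →*₀ E :=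
  quotChar (χ2 * monChar emb {σ | σ ∉ J} (fun σ => d σ - i σ)) (χ1 * monChar emb J i)

lemma lFun2_eq_singChar (a : F) :
    lFun2 emb J d χ1 χ2 a i = fun z => singChar emb J d χ1 χ2 i (z - a) := by
  funext z
  simp only [lFun2, quotChar_apply, sub_eq_zero, chRatio, negPow, div_mul_div_comm,
    MonoidHom.mul_apply, monChar_not_mem]
  rfl

lemma chRatio_mul_dPow_mul_singChar_inv (hid : ∀ σ, σ ∉ J → i σ ≤ d σ)
    (hχ1 : ∀ z : F, z ≠ 0 → χ1 z ≠ 0) {z : F} (hz : z ≠ 0) :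
    chRatio χ1 χ2 z * dPow emb J d z * singChar emb J d χ1 χ2 i z⁻¹ = mPow emb z i := by
  have hsing : singChar emb J d χ1 χ2 i z ≠ 0 := (map_ne_zero _).mpr hz
  rw [map_inv₀, mul_inv_eq_iff_eq_mul₀ hsing]
  have h1 := hχ1 z hz
  have hne : ∀ σ, emb σ z ≠ 0 := fun σ => (map_ne_zero _).mpr hz
  have hsplit : mPow emb z i = (∏ σ ∈ Finset.univ.filter (fun σ => σ ∈ J), emb σ z ^ i σ) *
      ∏ σ ∈ Finset.univ.filter (fun σ => σ ∉ J), emb σ z ^ i σ :=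
    (Finset.prod_filter_mul_prod_filter_not _ _ _).symm
  have hd : dPow emb J d z = (∏ σ ∈ Finset.univ.filter (fun σ => σ ∉ J), emb σ z ^ i σ) *
      ∏ σ ∈ Finset.univ.filter (fun σ => σ ∉ J), emb σ z ^ (d σ - i σ) := by
    rw [← Finset.prod_mul_distrib]
    refine Finset.prod_congr rfl fun σ hσ => ?_
    rw [← pow_add, Nat.add_sub_cancel' (hid σ (Finset.mem_filter.mp hσ).2)]
  have hJ : (∏ σ ∈ Finset.univ.filter (fun σ => σ ∈ J), emb σ z ^ i σ) ≠ 0 :=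
    Finset.prod_ne_zero_iff.mpr fun σ _ => pow_ne_zero _ (hne σ)
  have hs : singChar emb J d χ1 χ2 i z =
      (χ2 z * ∏ σ ∈ Finset.univ.filter (fun σ => σ ∉ J), emb σ z ^ (d σ - i σ)) /
      (χ1 z * ∏ σ ∈ Finset.univ.filter (fun σ => σ ∈ J), emb σ z ^ i σ) := by
    rw [quotChar_apply, if_neg hz, MonoidHom.mul_apply, monChar_not_mem]
    rfl
  rw [hs, hsplit, hd, chRatio]
  field_simp

lemma singChar_mul_mPow (k : S → ℕ) (z : F) :
    quotChar (χ2 * monChar emb {σ | σ ∉ J} (fun σ => d σ - i σ) * monChar emb Set.univ k)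
      (χ1 * monChar emb J i) z = mPow emb z k * singChar emb J d χ1 χ2 i z := by
  simp only [quotChar_apply, MonoidHom.mul_apply, monChar_univ]
  split_ifs
  · simp
  · ring

/-- expansion of `z^i` in powers of `1 - a z` -/
lemma mPow_eq_sum_one_sub {a : F} (ha : a ≠ 0) (z : F) :
    mPow emb z i = ∑ k ∈ Fintype.piFinset fun σ => Finset.range (i σ + 1),
      mPow emb a⁻¹ i * (∏ σ, ((i σ).choose (k σ) : E)) * mPow emb (-1) k *
        mPow emb (1 + -a * z) k := by
  have hz : z = a⁻¹ * (1 + -1 * (1 + -a * z)) := by field_simp; ring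
  conv_lhs => rw [hz, mPow_mul_base, mPow_add, Finset.mul_sum]
  refine Finset.sum_congr rfl fun k _ => ?_
  rw [mPow_mul_base, show mPow emb (1 : F) (fun σ => i σ - k σ) = 1 by simp [mPow]]
  ring

end Generators

/-- Lemme "funzionicr": with J' = J ∪ {σ ∉ J : d_σ+1 > r}, χ1' = χ1,
χ2' = χ2 ∏_{σ∈J'∖J} σ^{d_σ}, and assuming the integrality condition
v_p(χ1(p)) + v_p(χ2(p)) + |d| = 0, for every a ∈ F and every multi-index (k,m)
(encoded by i, with k ≤ d off J') such that r - |k| - |m| > 0, the functions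
z ↦ z^k z^m and z ↦ χ2'χ1'⁻¹(z-a)(z-a)^{d'-k}(z-a)^{-m} (value 0 at z = a) belong to
B(χ',J',d'); in particular z ↦ χ2'χ1'⁻¹(z) z^{d'-k} z^{-m} (value 0 at 0) lies in
C^r(O_F,J',d'). -/
theorem statement6
    {p q e f0 : ℕ} (hp : 1 < p) (hf0 : 0 < f0) (he : 0 < e) (hq : q = p ^ f0)
    {F E : Type*} [NormedField F] [NormedField E]
    [IsUltrametricDist F] [IsUltrametricDist E]
    [CompleteSpace F] [CompleteSpace E]
    (ϖ : F) (hϖ : ‖ϖ‖ = (q : ℝ)⁻¹)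
    (hval : ∀ x : F, x ≠ 0 → ∃ n : ℤ, ‖x‖ = (q : ℝ) ^ n)
    (hres : ∀ (a : F) (n : ℤ), ∃ R : Finset F, R.card = q ∧
      (∀ x ∈ R, ‖x - a‖ ≤ (q : ℝ) ^ (-n)) ∧
      ∀ z : F, ‖z - a‖ ≤ (q : ℝ) ^ (-n) → ∃! x, x ∈ R ∧ ‖z - x‖ ≤ (q : ℝ) ^ (-(n + 1)))
    (hpF : ‖(p : F)‖ = (q : ℝ) ^ (-(e : ℤ)))
    (hpE : ‖(p : E)‖ = (p : ℝ) ^ (-((e * f0 : ℕ) : ℤ)))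
    {S : Type*} [Fintype S] (emb : S → (F →+* E))
    (hemb : ∀ (σ : S) (z : F), ‖emb σ z‖ = ‖z‖)
    (J : Set S) (d : S → ℕ) (χ1 χ2 : F →* E)
    (hχ1 : IsLocJChar q emb J χ1) (hχ2 : IsLocJChar q emb J χ2)
    (hχ1ne : ∀ z : F, z ≠ 0 → χ1 z ≠ 0) (hχ2ne : ∀ z : F, z ≠ 0 → χ2 z ≠ 0)
    (r : ℝ) (hrdef : r = -vP p (e * f0) (χ1 (p : F))) (hr0 : 0 ≤ r)
    (J' : Set S) (hJ' : J' = J ∪ {σ : S | σ ∉ J ∧ r < (d σ : ℝ) + 1})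
    (χ2' : F →* E) (hχ2' : χ2' = χ2 * monChar emb {σ : S | σ ∈ J' ∧ σ ∉ J} d)
    (hcentral : vP p (e * f0) (χ1 (p : F)) + vP p (e * f0) (χ2 (p : F))
      + (dSum J d : ℝ) = 0) :
    ∀ (a : F) (i : S → ℕ), (∀ σ, σ ∉ J' → i σ ≤ d σ) → (mSum i : ℝ) < r →
      MemB q emb r J' d χ1 χ2' (fun z : F => mPow emb z i) ∧
      MemB q emb r J' d χ1 χ2' (lFun2 emb J' d χ1 χ2' a i) ∧
      IsCrJ q emb r J' d (lFun2 emb J' d χ1 χ2' 0 i) := by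
  intro a i hid hir
  have hq1 : 1 < q := by rw [hq]; exact Nat.one_lt_pow hf0.ne' hp
  have hef : 0 < e * f0 := Nat.mul_pos he hf0
  have hp1 : (1 : ℝ) < p := by exact_mod_cast hp
  have hp0 : (0 : ℝ) < p := by linarith
  have hpnorm : ‖(p : F)‖ = (p : ℝ) ^ (-((e * f0 : ℕ) : ℤ)) := by
    rw [hpF, hq, Nat.cast_pow, ← zpow_natCast, ← zpow_mul]
    congr 1; push_cast; ring
  have hπ0 : 0 < ‖(p : F)‖ := by rw [hpnorm]; exact zpow_pos hp0 _
  have hpne : (p : F) ≠ 0 := norm_pos_iff.mp hπ0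
  have : CharZero E := by
    refine charZero_of_norm_natCast_lt_one (p := p) (by rw [hpE]; exact zpow_pos hp0 _) ?_
    rw [hpE]
    exact zpow_lt_one_of_neg₀ hp1 (by omega)
  have hJJ' : J ⊆ J' := by rw [hJ']; exact Set.subset_union_left
  have hr : 0 < r := lt_of_le_of_lt (Nat.cast_nonneg _) hir
  -- the characters `w ↦ w^k φ(w)` for `k ≤ i`
  set φ := singChar emb J' d χ1 χ2' i with hφ
  set ψ : (S → ℕ) → F →*₀ E := fun k =>
    quotChar (χ2' * monChar emb {σ | σ ∉ J'} (fun σ => d σ - i σ) * monChar emb Set.univ k)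
      (χ1 * monChar emb J' i) with hψ
  have hψφ : ∀ k z, ψ k z = mPow emb z k * φ z := fun k z => singChar_mul_mPow k z
  have hψjet : ∀ k : S → ℕ, (∀ σ, k σ ≤ i σ) → HasJetOne emb ⌊r⌋₊ J' d (ψ k) := by
    intro k hk
    refine hasJetOne_quotChar hemb ?_ ?_
    · rw [hχ2']
      refine ((((hχ2.hasJetOne hq1 hϖ hemb).mono hJJ' (b' := 0) fun _ _ => le_rfl).mul hemb
        (hasJetOne_monChar _ _)).mul hemb (hasJetOne_monChar _ _) |>.mul hemb
        (hasJetOne_monChar _ _)).mono subset_rfl fun σ hσ => ?_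
      have h1 := hk σ
      have h2 := hid σ hσ
      simp only [Pi.add_apply, Pi.zero_apply, Set.mem_ofPred_eq, hσ, Set.mem_univ]
      simp
      omega
    · refine ((((hχ1.hasJetOne hq1 hϖ hemb).mono hJJ' (b' := 0) fun _ _ => le_rfl).mul hemb
        (hasJetOne_monChar _ _))).mono subset_rfl fun σ hσ => ?_
      simp [hσ]
  have hψp : ∀ k : S → ℕ, ‖ψ k (p : F)‖ = ‖(p : F)‖ ^ (2 * r - mSum i + mSum k) := by
    intro k
    have hv1 : ‖χ1 (p : F)‖ = ‖(p : F)‖ ^ vP p (e * f0) (χ1 (p : F)) := by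
      rw [hpnorm, rpow_vP hp hef (hχ1ne _ hpne)]
    have hv2 : ‖χ2 (p : F)‖ = ‖(p : F)‖ ^ vP p (e * f0) (χ2 (p : F)) := by
      rw [hpnorm, rpow_vP hp hef (hχ2ne _ hpne)]
    have hsum : (∑ σ, {σ : S | σ ∈ J' ∧ σ ∉ J}.indicator d σ)
        + (∑ σ, {σ : S | σ ∉ J'}.indicator (fun σ => d σ - i σ) σ) + mSum i
        = dSum J d + ∑ σ, J'.indicator i σ := by
      rw [dSum, mSum, Finset.sum_filter, ← Finset.sum_add_distrib, ← Finset.sum_add_distrib,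
        ← Finset.sum_add_distrib]
      refine Finset.sum_congr rfl fun σ _ => ?_
      by_cases hσ' : σ ∈ J'
      · by_cases hσ : σ ∈ J <;> simp [hσ, hσ']
      · have hσ : σ ∉ J := fun h => hσ' (hJJ' h)
        have := hid σ hσ'
        simp [hσ, hσ']
        omega
    have hk : (∑ σ, Set.univ.indicator k σ) = mSum k := by simp [mSum]
    rw [quotChar_apply, if_neg hpne, hχ2']
    simp only [MonoidHom.mul_apply, norm_div, norm_mul, norm_monChar hemb, hv1, hv2]
    rw [← Real.rpow_natCast, ← Real.rpow_natCast, ← Real.rpow_natCast, ← Real.rpow_natCast,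
      ← Real.rpow_add hπ0, ← Real.rpow_add hπ0, ← Real.rpow_add hπ0, ← Real.rpow_add hπ0,
      ← Real.rpow_sub hπ0]
    congr 1
    have hsum' := congrArg (Nat.cast : ℕ → ℝ) hsum
    have hk' := congrArg (Nat.cast : ℕ → ℝ) hk
    simp only [Nat.cast_add] at hsum'
    linarith
  have hcr : ∀ k : S → ℕ, (∀ σ, k σ ≤ i σ) → ∀ b c : F,
      IsCrJ q emb r J' d (fun z => ψ k (b + c * z)) := by
    intro k hk b c
    have hk0 : (0 : ℝ) ≤ mSum k := Nat.cast_nonneg _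
    refine isCrJ_comp_affine hq1 hemb hr0 (s := 2 * r - mSum i + mSum k) (by linarith)
      (norm_map_eq_rpow he hq1 hval (fun u hu => norm_map_eq_one_of_norm_eq_one hq1 hres
        ((hψjet k hk).isBigO_one hemb) hu) hpF (by linarith) (hψp k)) (hψjet k hk) b c
  have hφcr : ∀ b : F, IsCrJ q emb r J' d (lFun2 emb J' d χ1 χ2' b i) := by
    intro b
    have h := hcr 0 (fun σ => Nat.zero_le _) (-b) 1
    rw [lFun2_eq_singChar]
    convert h using 2 with z
    rw [hψφ, hφ, show mPow emb (-b + 1 * z) 0 = 1 by simp [mPow], one_mul]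
    congr 1; ring
  have hpoly : IsCrJ q emb r J' d (fun z : F => mPow emb z i) :=
    isCrJ_mPow hq1 hemb hr0 hid (Nat.le_floor hir.le)
  have hinv : ∀ z : F, z ≠ 0 →
      chRatio χ1 χ2' z * dPow emb J' d z * φ z⁻¹ = mPow emb z i := fun z hz =>
    chRatio_mul_dPow_mul_singChar_inv hid hχ1ne hz
  refine ⟨⟨hpoly, _, hφcr 0, fun z hz _ => ?_⟩,
    ⟨hφcr a, fun z => mPow emb z i * φ (1 + -a * z), ?_, fun z hz _ => ?_⟩, hφcr 0⟩
  · have hφz : φ z ≠ 0 := (map_ne_zero φ).mpr hz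
    have hmz : mPow emb z⁻¹ i * mPow emb z i = 1 := by
      rw [← mPow_mul_base, inv_mul_cancel₀ hz]; simp [mPow]
    have h := hinv z hz
    rw [map_inv₀, mul_inv_eq_iff_eq_mul₀ hφz] at h
    rw [lFun2_eq_singChar, h]
    change φ (z - 0) = _
    rw [sub_zero]
    linear_combination -(φ z) * hmz
  · rcases eq_or_ne a 0 with rfl | ha
    · simpa using hpoly
    · have heq : (fun z : F => mPow emb z i * φ (1 + -a * z)) = fun z =>
          ∑ k ∈ Fintype.piFinset fun σ => Finset.range (i σ + 1),
            (mPow emb a⁻¹ i * (∏ σ, ((i σ).choose (k σ) : E)) * mPow emb (-1) k) *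
              ψ k (1 + -a * z) := by
        funext z
        rw [mPow_eq_sum_one_sub ha z, Finset.sum_mul]
        exact Finset.sum_congr rfl fun k _ => by rw [hψφ]; ring
      rw [heq]
      refine IsCrJ.sum _ fun k hk => (hcr k (fun σ => ?_) 1 (-a)).const_mul _
      have := Fintype.mem_piFinset.mp hk σ
      exact Nat.lt_succ_iff.mp (Finset.mem_range.mp this)
  · rw [lFun2_eq_singChar]
    have hfac : z⁻¹ - a = z⁻¹ * (1 + -a * z) := by field_simp; ring
    simp only [hfac, map_mul]
    rw [← mul_assoc, hinv z hz]
end Paper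
end
end

section
/- Let J ⊆ S, d = (d_σ)_{σ∈S∖J} nonnegative integers, and χ1, χ2 : F^× → E^× locally J-analytic characters. If there exists f ∈ V(χ,J,d) whose gauge ‖f‖_Λ := inf{ |λ| : λ ∈ E^×, f ∈ λΛ } is strictly positive, then v_p(χ1(p)) + v_p(χ2(p)) + |d| = 0 (i.e. the central character is integral). -/
/- Preamble: formalization of the basic objects from "Fonctions de classe C^r sur O_F"
   (C^r functions on O_F, locally analytic functions, locally J-analytic characters,
   the spaces V(χ,J,d), B(χ,J,d), the lattice Λ, etc.).

   Conventions:
   * F, E are nonarchimedean complete normed fields (abstracting finite extensions of ℚ_p);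
   * O_F is encoded by the predicate ‖·‖ ≤ 1, and functions on O_F are encoded as
     functions on F whose defining conditions only quantify over the unit ball;
   * `q` is the residue cardinality, `ϖ` a uniformizer with ‖ϖ‖ = q⁻¹,
     and D(a,n) = {z : ‖z - a‖ ≤ q^(-n)};
   * S is the (finite) set of embeddings F → E, `emb σ` the corresponding ring maps;
   * multi-indices are functions `i : S → ℕ`; a pair (k over S∖J, m over J) is encoded
     as the single multi-index agreeing with k off J and with m on J. -/

open scoped Classical Topology
open Filter

noncomputable section

namespace Paper

variable {F E : Type*} [NormedField F] [NormedField E]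
variable {S : Type*} [Fintype S]

/-- The scalar by which the central element `diag(t, t)` acts. -/
def centralScalar (emb : S → (F →+* E)) (J : Set S) (d : S → ℕ) (χ1 χ2 : F →* E)
    (t : F) : E :=
  χ1 (t * t) * chRatio χ1 χ2 t * dPow emb J d t

lemma chRatio_mul (χ1 χ2 : F →* E) (s t : F) :
    chRatio χ1 χ2 (s * t) = chRatio χ1 χ2 s * chRatio χ1 χ2 t := by
  simp only [chRatio, map_mul, mul_div_mul_comm]

lemma dPow_mul (emb : S → (F →+* E)) (J : Set S) (d : S → ℕ) (s t : F) :
    dPow emb J d (s * t) = dPow emb J d s * dPow emb J d t := by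
  simp only [dPow, map_mul, mul_pow, Finset.prod_mul_distrib]

lemma norm_dPow {emb : S → (F →+* E)} (hemb : ∀ (σ : S) (z : F), ‖emb σ z‖ = ‖z‖)
    (J : Set S) (d : S → ℕ) (z : F) : ‖dPow emb J d z‖ = ‖z‖ ^ dSum J d := by
  simp only [dPow, dSum, norm_prod, norm_pow, hemb, Finset.prod_pow_eq_pow_sum]

lemma centralScalar_mul (emb : S → (F →+* E)) (J : Set S) (d : S → ℕ) (χ1 χ2 : F →* E)
    (s t : F) :
    centralScalar emb J d χ1 χ2 (s * t) =
      centralScalar emb J d χ1 χ2 s * centralScalar emb J d χ1 χ2 t := by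
  simp only [centralScalar, chRatio_mul, dPow_mul, map_mul]
  ring

lemma centralScalar_one {χ1 χ2 : F →* E} (emb : S → (F →+* E)) (J : Set S) (d : S → ℕ) :
    centralScalar emb J d χ1 χ2 1 = 1 := by
  simp [centralScalar, chRatio, dPow]

lemma centralScalar_smul_borelAct (emb : S → (F →+* E)) (J : Set S) (d : S → ℕ)
    (χ1 χ2 : F →* E) {s : F} (hs : s ≠ 0) (t u v : F) (f : F → E) :
    centralScalar emb J d χ1 χ2 s • borelAct emb J d χ1 χ2 t u v f =
      borelAct emb J d χ1 χ2 (s * t) (s * u) (s * v) f := by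
  funext z
  have h : (s * v * z - s * u) / (s * t) = (v * z - u) / t := by
    rw [mul_assoc, ← mul_sub, mul_div_mul_left _ _ hs]
  simp only [centralScalar, borelAct, Pi.smul_apply, smul_eq_mul, h, chRatio_mul, dPow_mul,
    map_mul]
  ring

/-- `Λ` is stable under the centre of `GL₂(F)`. -/
lemma centralScalar_smul_mem_Lambda [IsUltrametricDist E] (emb : S → (F →+* E)) (J : Set S)
    (d : S → ℕ) (χ1 χ2 : F →* E) {s : F} (hs : s ≠ 0) {g : F → E}
    (hg : g ∈ Lambda emb J d χ1 χ2) :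
    centralScalar emb J d χ1 χ2 s • g ∈ Lambda emb J d χ1 χ2 := by
  induction hg using Submodule.span_induction with
  | mem h hh =>
    obtain ⟨t, u, v, i, ht, hv, hi, hh⟩ := hh
    refine Submodule.subset_span
      ⟨s * t, s * u, s * v, i, mul_ne_zero hs ht, mul_ne_zero hs hv, hi, ?_⟩
    rcases hh with rfl | rfl
    · exact Or.inl (centralScalar_smul_borelAct emb J d χ1 χ2 hs t u v _)
    · exact Or.inr (centralScalar_smul_borelAct emb J d χ1 χ2 hs t u v _)
  | zero => simp
  | add x y _ _ hx hy => rw [smul_add]; exact Submodule.add_mem _ hx hy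
  | smul a x _ hx =>
    have h : centralScalar emb J d χ1 χ2 s • a • x = a • centralScalar emb J d χ1 χ2 s • x := by
      funext z
      exact mul_left_comm _ (a : E) _
    rw [h]
    exact Submodule.smul_mem _ _ hx

/-- A scalar stabilizing a lattice for which some gauge is positive is integral. -/
lemma norm_le_one_of_lamGauge_pos {X : Type*} [IsUltrametricDist E]
    {L : Submodule ↥(unitBall E) (X → E)} {f : X → E} (hf : 0 < lamGauge L f) {x : E}
    (hx : ∀ g ∈ L, x • g ∈ L) : ‖x‖ ≤ 1 := by
  by_contra! hlt
  have hx0 : x ≠ 0 := norm_pos_iff.1 (zero_lt_one.trans hlt)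
  have hne : {c : ℝ | ∃ lam : E, lam ≠ 0 ∧ c = ‖lam‖ ∧ ∃ g, g ∈ L ∧ f = lam • g}.Nonempty := by
    by_contra h
    rw [Set.not_nonempty_iff_eq_empty] at h
    simp [lamGauge, h] at hf
  obtain ⟨_, lam, hlam, -, g, hg, rfl⟩ := hne
  have hpow : ∀ n : ℕ, x ^ n • g ∈ L := by
    intro n
    induction n with
    | zero => simpa using hg
    | succ n ih => rw [pow_succ', mul_smul]; exact hx _ ih
  have hle : ∀ n : ℕ, lamGauge L (lam • g) ≤ ‖lam‖ * ‖x‖⁻¹ ^ n := by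
    intro n
    refine csInf_le ⟨0, ?_⟩ ⟨lam * (x⁻¹) ^ n, mul_ne_zero hlam (pow_ne_zero _ (inv_ne_zero hx0)),
      by simp, x ^ n • g, hpow n, ?_⟩
    · rintro _ ⟨μ, -, rfl, -⟩
      exact norm_nonneg μ
    · rw [smul_smul, mul_assoc, ← mul_pow, inv_mul_cancel₀ hx0, one_pow, mul_one]
  have hlim : Tendsto (fun n : ℕ => ‖lam‖ * ‖x‖⁻¹ ^ n) atTop (𝓝 (‖lam‖ * 0)) :=
    (tendsto_pow_atTop_nhds_zero_of_lt_one (by positivity) (inv_lt_one_of_one_lt₀ hlt)).const_mul _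
  rw [mul_zero] at hlim
  exact hf.not_ge (ge_of_tendsto' hlim hle)

/-- The central character is integral as soon as some gauge for `Λ` is positive. -/
lemma norm_centralScalar_eq_one [IsUltrametricDist E] {emb : S → (F →+* E)} {J : Set S}
    {d : S → ℕ} {χ1 χ2 : F →* E} {f : F → E} (hf : 0 < lamGauge (Lambda emb J d χ1 χ2) f)
    {s : F} (hs : s ≠ 0) : ‖centralScalar emb J d χ1 χ2 s‖ = 1 := by
  have hle : ∀ t : F, t ≠ 0 → ‖centralScalar emb J d χ1 χ2 t‖ ≤ 1 := fun t ht =>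
    norm_le_one_of_lamGauge_pos hf fun _ hg => centralScalar_smul_mem_Lambda emb J d χ1 χ2 ht hg
  have hmul : ‖centralScalar emb J d χ1 χ2 s‖ * ‖centralScalar emb J d χ1 χ2 s⁻¹‖ = 1 := by
    rw [← norm_mul, ← centralScalar_mul, mul_inv_cancel₀ hs, centralScalar_one, norm_one]
  refine le_antisymm (hle s hs) ?_
  calc (1 : ℝ) = _ := hmul.symm
    _ ≤ ‖centralScalar emb J d χ1 χ2 s‖ * 1 :=
      mul_le_mul_of_nonneg_left (hle _ (inv_ne_zero hs)) (norm_nonneg _)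
    _ = _ := mul_one _

/-- Proposition "nullita" (i): if some f ∈ V(χ,J,d) has strictly positive
gauge ‖f‖_Λ = inf{|λ| : λ ∈ E^×, f ∈ λΛ}, then the central character is integral, i.e.
v_p(χ1(p)) + v_p(χ2(p)) + |d| = 0. -/
theorem statement7
    {p q e f0 : ℕ} (hp : 1 < p) (hf0 : 0 < f0) (he : 0 < e) (hq : q = p ^ f0)
    {F E : Type*} [NormedField F] [NormedField E]
    [IsUltrametricDist F] [IsUltrametricDist E]
    [CompleteSpace F] [CompleteSpace E]
    (ϖ : F) (hϖ : ‖ϖ‖ = (q : ℝ)⁻¹)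
    (hval : ∀ x : F, x ≠ 0 → ∃ n : ℤ, ‖x‖ = (q : ℝ) ^ n)
    (hres : ∀ (a : F) (n : ℤ), ∃ R : Finset F, R.card = q ∧
      (∀ x ∈ R, ‖x - a‖ ≤ (q : ℝ) ^ (-n)) ∧
      ∀ z : F, ‖z - a‖ ≤ (q : ℝ) ^ (-n) → ∃! x, x ∈ R ∧ ‖z - x‖ ≤ (q : ℝ) ^ (-(n + 1)))
    (hpF : ‖(p : F)‖ = (q : ℝ) ^ (-(e : ℤ)))
    (hpE : ‖(p : E)‖ = (p : ℝ) ^ (-((e * f0 : ℕ) : ℤ)))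
    {S : Type*} [Fintype S] (emb : S → (F →+* E))
    (hemb : ∀ (σ : S) (z : F), ‖emb σ z‖ = ‖z‖)
    (J : Set S) (d : S → ℕ) (χ1 χ2 : F →* E)
    (hχ1 : IsLocJChar q emb J χ1) (hχ2 : IsLocJChar q emb J χ2)
    (hχ1ne : ∀ z : F, z ≠ 0 → χ1 z ≠ 0) (hχ2ne : ∀ z : F, z ≠ 0 → χ2 z ≠ 0)
    (hex : ∃ f : F → E, MemV q emb J d χ1 χ2 f ∧
      0 < lamGauge (Lambda emb J d χ1 χ2) f) :
    vP p (e * f0) (χ1 (p : F)) + vP p (e * f0) (χ2 (p : F)) + (dSum J d : ℝ) = 0 := by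
  obtain ⟨f, -, hf⟩ := hex
  have hp1 : (1 : ℝ) < p := by exact_mod_cast hp
  have hnorm : ‖(p : F)‖ = (p : ℝ) ^ (-((e * f0 : ℕ) : ℤ)) := by
    rw [hpF, hq]
    push_cast
    rw [← zpow_natCast, ← zpow_mul]
    congr 1
    ring
  have hp0 : (p : F) ≠ 0 := by
    rw [← norm_pos_iff, hnorm]
    positivity
  have hone := norm_centralScalar_eq_one hf hp0
  have h1 : ‖χ1 (p : F)‖ ≠ 0 := norm_ne_zero_iff.2 (hχ1ne _ hp0)
  have h2 : ‖χ2 (p : F)‖ ≠ 0 := norm_ne_zero_iff.2 (hχ2ne _ hp0)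
  have h3 : ‖(p : F)‖ ^ dSum J d ≠ 0 := pow_ne_zero _ (norm_ne_zero_iff.2 hp0)
  have hprod : ‖χ1 (p : F)‖ * ‖χ2 (p : F)‖ * ‖(p : F)‖ ^ dSum J d = 1 := by
    rw [← hone, centralScalar, norm_mul, norm_mul, norm_dPow hemb, map_mul, chRatio, norm_mul,
      norm_div]
    field_simp
  have hlog := congrArg (Real.logb p) hprod
  rw [Real.logb_mul (mul_ne_zero h1 h2) h3, Real.logb_mul h1 h2, Real.logb_pow, Real.logb_one,
    hnorm, ← Real.rpow_intCast,
    Real.logb_rpow (zero_lt_one.trans hp1) hp1.ne'] at hlog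
  have hef : ((e * f0 : ℕ) : ℝ) ≠ 0 := by positivity
  rw [vP, vP, ← add_div, div_add' _ _ _ hef, div_eq_zero_iff]
  left
  push_cast at hlog ⊢
  linarith
end Paper
end
end
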